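/- arXiv:math/0102200 — 2 statements merged into one kernel-verified Lean document; each statement's English description precedes it below -/
import Mathlib

section
/- Let G=(V,w) be a weighted graph, o a vertex and z a set of vertices with dist(o,z) ≥ n+1 for an integer n ≥ 1, set g := (w_z r_{oz})^{1/n} where r_{oz} is the effective resistance between o and z, assume g > 1, and let 1 < a < (g+1)/(g−1). Then P(T_{oz} ≤ an+1) ≤ e^{−I_g(a) n}, where e^{−I_g(a)} = (g/(a+1)) · (g/(a²−1))^{(a−1)/2} · (2a/(g+1))^a. -/
open MeasureTheory Filter
open scoped Classical ENNReal

namespace RWHitting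

/-- A weighted graph on a vertex set `V`: a symmetric weight function with
positive finite vertex weights. -/
structure WeightedGraph (V : Type*) where
  w : V → V → ℝ≥0∞
  symm : ∀ x y, w x y = w y x
  vw_pos : ∀ x, 0 < ∑' y, w x y
  vw_lt_top : ∀ x, ∑' y, w x y < ⊤

namespace WeightedGraph

variable {V : Type*}

/-- The weight of a vertex. -/
noncomputable def vw (G : WeightedGraph V) (x : V) : ℝ≥0∞ := ∑' y, G.w x y

/-- The weight of a vertex set. -/
noncomputable def setWeight (G : WeightedGraph V) (z : Set V) : ℝ≥0∞ := ∑' x : z, G.vw x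

/-- `G.distGE o z m` : every path of positive-weight steps from `o` into `z` has length `≥ m`. -/
def distGE (G : WeightedGraph V) (o : V) (z : Set V) (m : ℕ) : Prop :=
  ∀ (k : ℕ) (p : ℕ → V), p 0 = o → (∀ i, i < k → 0 < G.w (p i) (p (i+1))) → p k ∈ z → m ≤ k

/-- Transition probabilities of the random walk on `G`. -/
noncomputable def trans (G : WeightedGraph V) (x y : V) : ℝ≥0∞ := G.w x y / G.vw x

/-- Graph distance (as an extended nonneg real). -/
noncomputable def edist (G : WeightedGraph V) (x y : V) : ℝ≥0∞ :=
  ⨅ (k : ℕ) (_ : ∃ p : ℕ → V, p 0 = x ∧ p k = y ∧ ∀ i, i < k → 0 < G.w (p i) (p (i+1))),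
    (k : ℝ≥0∞)

/-- Total weight of the edges at distance `n` from `o` (each non-loop edge counted in both
orientations). -/
noncomputable def boundaryWeight (G : WeightedGraph V) (o : V) (n : ℕ) : ℝ≥0∞ :=
  ∑' q : V × V, if min (G.edist o q.1) (G.edist o q.2) = (n : ℝ≥0∞) then G.w q.1 q.2 else 0

end WeightedGraph

variable {V : Type*}

/-- `μ` is the law of the random walk on `G` started at `o`. -/
def IsRandomWalk [MeasurableSpace V] (G : WeightedGraph V) (o : V)
    (μ : Measure (ℕ → V)) : Prop :=
  IsProbabilityMeasure μ ∧
  ∀ (k : ℕ) (x : Fin (k+1) → V),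
    μ {ω | ∀ i : Fin (k+1), ω (i : ℕ) = x i}
      = (if x 0 = o then 1 else 0) * ∏ i : Fin k, G.trans (x i.castSucc) (x i.succ)

/-- First hitting time of the set `z` (`∞` if `z` is never visited). -/
noncomputable def hitTime (z : Set V) (ω : ℕ → V) : ℝ≥0∞ :=
  ⨅ (k : ℕ) (_ : ω k ∈ z), (k : ℝ≥0∞)

/-- Expected hitting time of `z`. -/
noncomputable def expHit [MeasurableSpace V] (μ : Measure (ℕ → V)) (z : Set V) : ℝ≥0∞ :=
  ∫⁻ ω, hitTime z ω ∂μ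

/-- Number of visits to `o` (counting time 0) strictly before hitting `z`. -/
noncomputable def visitsBefore (z : Set V) (o : V) (ω : ℕ → V) : ℝ≥0∞ :=
  ∑' k : ℕ, if ω k = o ∧ (k : ℝ≥0∞) < hitTime z ω then 1 else 0

/-- Effective resistance between `o` and `z`, defined probabilistically via the random walk
law `μ`:  `w_o r_{oz}` is the expected number of visits to `o` before hitting `z`. -/
noncomputable def resistance [MeasurableSpace V] (G : WeightedGraph V) (o : V) (z : Set V)
    (μ : Measure (ℕ → V)) : ℝ≥0∞ :=
  (∫⁻ ω, visitsBefore z o ω ∂μ) / G.vw o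

/-- One-step transition probabilities for the biased simple random walk on `ℤ`
with odds `1 : g` of going left/right. -/
noncomputable def biasedStep (g : ℝ) (a b : ℤ) : ℝ≥0∞ :=
  if b = a + 1 then ENNReal.ofReal (g / (g+1))
  else if b = a - 1 then ENNReal.ofReal (1 / (g+1)) else 0

/-- `ν` is the law of the biased simple random walk on `ℤ` started at `0`,
stepping right with probability `g/(g+1)` and left with probability `1/(g+1)`. -/
def IsBiasedWalk (g : ℝ) (ν : Measure (ℕ → ℤ)) : Prop :=
  IsProbabilityMeasure ν ∧
  ∀ (k : ℕ) (x : Fin (k+1) → ℤ),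
    ν {ω | ∀ i : Fin (k+1), ω (i : ℕ) = x i}
      = (if x 0 = 0 then 1 else 0) * ∏ i : Fin k, biasedStep g (x i.castSucc) (x i.succ)

/-- `e^{-λ t}` for an extended-real time `t`, with the convention `e^{-λ ∞} = 0`. -/
noncomputable def expNeg (lam : ℝ) (t : ℝ≥0∞) : ℝ≥0∞ :=
  if t = ⊤ then 0 else ENNReal.ofReal (Real.exp (-lam * t.toReal))

section RealInequalities

/-- The function `t ↦ t ^ (e - 1) * (s - t) / (1 - s * t)` on `[0, s]` is maximal at the
point `t₀` where its logarithmic derivative vanishes. -/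
lemma rpow_mul_sub_le {s t₀ e η t : ℝ} (hs1 : s < 1) (ht₀ : 0 < t₀) (ht₀s : t₀ < s)
    (he : e - 1 = t₀ * (1 - s ^ 2) / ((s - t₀) * (1 - s * t₀)))
    (hη : η * (t₀ ^ (e - 1) * (s - t₀)) = 1 - s * t₀)
    (ht : 0 ≤ t) (hts : t ≤ s) :
    η * (t ^ (e - 1) * (s - t)) ≤ 1 - s * t := by
  have hs0 : 0 < s := ht₀.trans ht₀s
  have hd0 : 0 < s - t₀ := by linarith
  have h1 : 0 < 1 - s * t₀ := by nlinarith
  have h2 : 0 < 1 - s ^ 2 := by nlinarith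
  have h3 : 0 < 1 - s * t := by nlinarith
  have he1 : 0 < e - 1 := by rw [he]; positivity
  rcases ht.eq_or_lt with rfl | htpos
  · rw [Real.zero_rpow he1.ne']; simp
  rcases hts.eq_or_lt with rfl | hts
  · simp; nlinarith
  have hd : 0 < s - t := by linarith
  have hp0 : 0 < t₀ ^ (e - 1) := Real.rpow_pos_of_pos ht₀ _
  have hp : 0 < t ^ (e - 1) := Real.rpow_pos_of_pos htpos _
  have hη0 : 0 < η := by
    by_contra hc
    have : η * (t₀ ^ (e - 1) * (s - t₀)) ≤ 0 :=
      mul_nonpos_of_nonpos_of_nonneg (not_lt.1 hc) (by positivity)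
    linarith
  set u := t / t₀ with hu
  set v := ((s - t) / (1 - s * t)) / ((s - t₀) / (1 - s * t₀)) with hv
  have hu0 : 0 < u := by positivity
  have hv0 : 0 < v := by positivity
  have hα := Real.log_le_sub_one_of_pos (x := (1 - s * t) / (1 - s * t₀)) (by positivity)
  have hβ := Real.log_le_sub_one_of_pos (x := (1 - s * t₀) / (1 - s * t)) (by positivity)
  have hlu := Real.log_le_sub_one_of_pos hu0
  have hlv := Real.log_le_sub_one_of_pos hv0
  have hsum : Real.log ((1 - s * t) / (1 - s * t₀)) +
      Real.log ((1 - s * t₀) / (1 - s * t)) = 0 := by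
    rw [← Real.log_mul (by positivity) (by positivity)]
    rw [div_mul_div_comm, mul_comm, div_self (by positivity), Real.log_one]
  have e1 : (1 - s * t) / (1 - s * t₀) - 1 = s * t₀ / (1 - s * t₀) * (1 - u) := by
    rw [hu]; field_simp; ring
  have e2 : (1 - s * t₀) / (1 - s * t) - 1 = s * (s - t₀) / (1 - s ^ 2) * (1 - v) := by
    rw [hv]; field_simp; ring
  have k1 : 0 ≤ s * t₀ / (1 - s * t₀) := by positivity
  have k2 : 0 < s * (s - t₀) / (1 - s ^ 2) := by positivity
  have e3 : s * t₀ / (1 - s * t₀) = (s * (s - t₀) / (1 - s ^ 2)) * (e - 1) := by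
    rw [he]; field_simp
  have hfin : (s * (s - t₀) / (1 - s ^ 2)) * ((e - 1) * Real.log u + Real.log v) ≤ 0 := by
    nlinarith [mul_le_mul_of_nonneg_left hlu k1, mul_le_mul_of_nonneg_left hlv k2.le]
  have hfin' : (e - 1) * Real.log u + Real.log v ≤ 0 := by
    by_contra hc
    exact absurd (mul_pos k2 (not_le.1 hc)) (not_lt.2 hfin)
  have huv : u ^ (e - 1) * v ≤ 1 := by
    rw [← Real.log_nonpos_iff (by positivity), Real.log_mul (by positivity) hv0.ne',
      Real.log_rpow hu0]
    exact hfin'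
  have hue : u ^ (e - 1) = t ^ (e - 1) / t₀ ^ (e - 1) := Real.div_rpow ht ht₀.le _
  have hηe : η = (1 - s * t₀) / (t₀ ^ (e - 1) * (s - t₀)) := by
    rw [eq_div_iff (by positivity)]; exact hη
  have : η * (t ^ (e - 1) * (s - t)) = (1 - s * t) * (u ^ (e - 1) * v) := by
    rw [hηe, hue, hv]; field_simp
  rw [this]
  nlinarith

/-- Weighted AM-GM: the maximum of `t ^ (e - 1) * (s - t)` over `t ≥ 0`. -/
lemma rpow_mul_sub_le_max {s e t : ℝ} (hs : 0 < s) (he : 1 < e) (ht : 0 ≤ t) :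
    t ^ (e - 1) * (s - t) ≤ s ^ e * ((e - 1) / e) ^ (e - 1) / e := by
  have he0 : 0 < e := by linarith
  have he1 : 0 < e - 1 := by linarith
  rcases le_or_gt s t with hst | hst
  · have : t ^ (e - 1) * (s - t) ≤ 0 :=
      mul_nonpos_of_nonneg_of_nonpos (Real.rpow_nonneg ht _) (by linarith)
    exact this.trans (by positivity)
  rcases ht.eq_or_lt with rfl | ht
  · rw [Real.zero_rpow he1.ne', zero_mul]; positivity
  have hd : 0 < s - t := by linarith
  set p := (e - 1) / e * s with hp
  set q := s / e with hq
  have hp0 : 0 < p := by positivity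
  have hq0 : 0 < q := by positivity
  have h1 := Real.log_le_sub_one_of_pos (x := t / p) (by positivity)
  have h2 := Real.log_le_sub_one_of_pos (x := (s - t) / q) (by positivity)
  have h3 : (e - 1) * (t / p - 1) + ((s - t) / q - 1) = 0 := by
    rw [hp, hq]; field_simp; ring
  have h4 : (t / p) ^ (e - 1) * ((s - t) / q) ≤ 1 := by
    rw [← Real.log_nonpos_iff (by positivity), Real.log_mul (by positivity) (by positivity),
      Real.log_rpow (by positivity)]
    nlinarith [mul_le_mul_of_nonneg_left h1 he1.le]
  rw [Real.div_rpow ht.le hp0.le, div_mul_div_comm,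
    div_le_one (by positivity)] at h4
  refine h4.trans_eq ?_
  have hse : s ^ e = s ^ (e - 1) * s := by
    rw [← Real.rpow_add_one hs.ne']; ring_nf
  rw [hp, hq, Real.mul_rpow (by positivity) hs.le, hse]
  ring

lemma edge_inequality_of_eq_or_succ {s e η p q : ℝ} (hs0 : 0 < s) (hs1 : s < 1) (he : 1 < e)
    (hη : 1 ≤ η)
    (hmax : ∀ t, 0 ≤ t → t ≤ s → η * (t ^ (e - 1) * (s - t)) ≤ 1 - s * t)
    (hp : 0 ≤ p) (hq : 0 ≤ q) :
    s * (η * p ^ (e - 1) * q + q ^ (e - 1) * p) ≤ η * p ^ (e - 1) * p + q ^ (e - 1) * q := by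
  have he1 : 0 < e - 1 := by linarith
  rcases hq.eq_or_lt with rfl | hq
  · rw [Real.zero_rpow he1.ne']
    have := Real.rpow_nonneg hp (e - 1)
    simp only [mul_zero, zero_mul, add_zero]
    positivity
  have hpt : p = p / q * q := by field_simp
  set t := p / q with htdef
  have ht : 0 ≤ t := by positivity
  have key : η * t ^ (e - 1) * (s - t) ≤ 1 - s * t := by
    rcases le_or_gt t s with hts | hts
    · have := hmax t ht hts
      rwa [← mul_assoc] at this
    · have h0 : 0 ≤ η * t ^ (e - 1) := by positivity
      rcases le_or_gt t 1 with h1 | h1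
      · have : η * t ^ (e - 1) * (s - t) ≤ 0 :=
          mul_nonpos_of_nonneg_of_nonpos h0 (by linarith)
        nlinarith
      · have h2 : 1 ≤ t ^ (e - 1) := Real.one_le_rpow h1.le he1.le
        have h3 : 1 ≤ η * t ^ (e - 1) := by nlinarith
        nlinarith
  have hpe : p ^ (e - 1) = t ^ (e - 1) * q ^ (e - 1) := by
    rw [hpt, Real.mul_rpow ht hq.le]
  have hQ : 0 ≤ q ^ (e - 1) * q := by positivity
  rw [hpe, hpt]
  have := mul_le_mul_of_nonneg_left key hQ
  nlinarith

end RealInequalities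

section KilledWalk

variable (G : WeightedGraph V) (z : Set V)

/-- One step of the transition operator of the walk killed on `z`. -/
noncomputable def killedStep (f : V → ℝ≥0∞) (x : V) : ℝ≥0∞ :=
  if x ∈ z then 0 else ∑' y, G.trans x y * f y

/-- The `s`-discounted Green operator of the walk killed on `z`. -/
noncomputable def killedGreen (s : ℝ≥0∞) (f : V → ℝ≥0∞) (x : V) : ℝ≥0∞ :=
  ∑' k : ℕ, s ^ k * (killedStep G z)^[k] f x

lemma vw_ne_zero (x : V) : G.vw x ≠ 0 := (G.vw_pos x).ne'

lemma vw_ne_top (x : V) : G.vw x ≠ ⊤ := (G.vw_lt_top x).ne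

lemma vw_mul_trans (x y : V) : G.vw x * G.trans x y = G.w x y :=
  ENNReal.mul_div_cancel (vw_ne_zero G x) (vw_ne_top G x)

lemma tsum_trans (x : V) : ∑' y, G.trans x y = 1 := by
  simp only [WeightedGraph.trans, div_eq_mul_inv, ENNReal.tsum_mul_right]
  exact ENNReal.mul_inv_cancel (vw_ne_zero G x) (vw_ne_top G x)

lemma killedStep_tsum {ι : Type*} (f : ι → V → ℝ≥0∞) (x : V) :
    killedStep G z (fun y => ∑' i, f i y) x = ∑' i, killedStep G z (f i) x := by
  unfold killedStep
  split_ifs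
  · simp
  · simp only [← ENNReal.tsum_mul_left]
    exact ENNReal.tsum_comm

lemma killedStep_const_mul (c : ℝ≥0∞) (f : V → ℝ≥0∞) (x : V) :
    killedStep G z (fun y => c * f y) x = c * killedStep G z f x := by
  unfold killedStep
  split_ifs
  · simp
  · simp only [← ENNReal.tsum_mul_left]
    exact tsum_congr fun y => by ring

lemma killedStep_add (f g : V → ℝ≥0∞) (x : V) :
    killedStep G z (fun y => f y + g y) x = killedStep G z f x + killedStep G z g x := by
  unfold killedStep
  split_ifs
  · simp
  · simp only [mul_add, ENNReal.tsum_add]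

lemma killedStep_mono {f g : V → ℝ≥0∞} (h : ∀ x, f x ≤ g x) (x : V) :
    killedStep G z f x ≤ killedStep G z g x := by
  unfold killedStep
  split_ifs
  · exact le_rfl
  · exact ENNReal.tsum_le_tsum fun y => by gcongr; exact h y

lemma killedGreen_eq (s : ℝ≥0∞) (f : V → ℝ≥0∞) (x : V) :
    killedGreen G z s f x = f x + s * killedStep G z (killedGreen G z s f) x := by
  have : killedStep G z (killedGreen G z s f) x
      = ∑' k : ℕ, s ^ k * (killedStep G z)^[k + 1] f x := by
    unfold killedGreen
    rw [killedStep_tsum]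
    refine tsum_congr fun k => ?_
    rw [killedStep_const_mul, Function.iterate_succ_apply']
  rw [this, ← ENNReal.tsum_mul_left, killedGreen, tsum_eq_zero_add' ENNReal.summable]
  simp [pow_succ', mul_assoc]

lemma sum_range_iterate_killedStep_succ (f : V → ℝ≥0∞) (m : ℕ) (x : V) :
    ∑ k ∈ Finset.range (m + 1), (killedStep G z)^[k] f x
      = f x + killedStep G z (fun y => ∑ k ∈ Finset.range m, (killedStep G z)^[k] f y) x := by
  have h : killedStep G z (fun y => ∑ k ∈ Finset.range m, (killedStep G z)^[k] f y) x
      = ∑ k ∈ Finset.range m, (killedStep G z)^[k + 1] f x := by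
    induction m with
    | zero => simp [killedStep]
    | succ m ih =>
      simp only [Finset.sum_range_succ] at ih ⊢
      rw [killedStep_add, ih, Function.iterate_succ_apply']
  rw [h, Finset.sum_range_succ', add_comm]
  simp

lemma killedGreen_indicator_le_one {s : ℝ≥0∞} (hs : s ≤ 1) (x : V) :
    killedGreen G z s (fun y => if y ∈ z then 1 else 0) x ≤ 1 := by
  refine ENNReal.tsum_le_of_sum_range_le fun m => ?_
  refine (Finset.sum_le_sum fun k _ =>
    mul_le_of_le_one_left zero_le (pow_le_one₀ zero_le hs)).trans ?_
  induction m generalizing x with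
  | zero => simp
  | succ m ih =>
    rw [sum_range_iterate_killedStep_succ]
    refine (add_le_add_right (killedStep_mono G z ih x) _).trans ?_
    unfold killedStep
    split_ifs <;> simp [tsum_trans]

lemma tsum_vw_mul_killedStep_le (f : V → ℝ≥0∞) :
    ∑' x, G.vw x * killedStep G z f x ≤ ∑' x, G.vw x * f x := by
  calc ∑' x, G.vw x * killedStep G z f x
      ≤ ∑' x, ∑' y, G.w x y * f y := by
        refine ENNReal.tsum_le_tsum fun x => ?_
        unfold killedStep
        split_ifs
        · simp
        · rw [← ENNReal.tsum_mul_left]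
          exact ENNReal.tsum_le_tsum fun y => by rw [← mul_assoc, vw_mul_trans]
    _ = ∑' y, ∑' x, G.w y x * f y := by
        rw [ENNReal.tsum_comm]
        exact tsum_congr fun y => tsum_congr fun x => by rw [G.symm]
    _ = ∑' x, G.vw x * f x := by
        simp only [ENNReal.tsum_mul_right, WeightedGraph.vw]

lemma tsum_vw_mul_killedGreen_ne_top {s : ℝ≥0∞} (hs : s < 1) {f : V → ℝ≥0∞}
    (hf : ∑' x, G.vw x * f x ≠ ⊤) :
    ∑' x, G.vw x * killedGreen G z s f x ≠ ⊤ := by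
  have hk : ∀ k, ∑' x, G.vw x * (killedStep G z)^[k] f x ≤ ∑' x, G.vw x * f x := by
    intro k
    induction k with
    | zero => simp
    | succ k ih =>
      simp only [Function.iterate_succ_apply']
      exact (tsum_vw_mul_killedStep_le G z _).trans ih
  have : ∑' x, G.vw x * killedGreen G z s f x ≤ (1 - s)⁻¹ * ∑' x, G.vw x * f x := by
    calc ∑' x, G.vw x * killedGreen G z s f x
        = ∑' k, s ^ k * ∑' x, G.vw x * (killedStep G z)^[k] f x := by
          simp only [killedGreen, ← ENNReal.tsum_mul_left]
          rw [ENNReal.tsum_comm]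
          exact tsum_congr fun k => tsum_congr fun x => by ring
      _ ≤ ∑' k, s ^ k * ∑' x, G.vw x * f x :=
          ENNReal.tsum_le_tsum fun k => mul_le_mul_right (hk k) _
      _ = _ := by rw [ENNReal.tsum_mul_right, ENNReal.tsum_geometric]
  refine ne_top_of_le_ne_top (ENNReal.mul_ne_top ?_ hf) this
  exact ENNReal.inv_ne_top.2 (tsub_pos_of_lt hs).ne'

end KilledWalk

section PathLaw

variable [Countable V] [MeasurableSpace V] [MeasurableSingletonClass V]

lemma lintegral_prefix {G : WeightedGraph V} {o : V} {μ : Measure (ℕ → V)}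
    (hμ : IsRandomWalk G o μ) (k : ℕ) (F : (Fin (k + 1) → V) → ℝ≥0∞) :
    ∫⁻ ω, F (fun i => ω i) ∂μ = ∑' x : Fin (k + 1) → V,
      F x * ((if x 0 = o then 1 else 0) * ∏ i : Fin k, G.trans (x i.castSucc) (x i.succ)) := by
  have hm : Measurable fun (ω : ℕ → V) (i : Fin (k + 1)) => ω i :=
    measurable_pi_lambda _ fun i => measurable_pi_apply _
  have hF : Measurable F := Measurable.of_discrete
  rw [← lintegral_map hF hm, lintegral_countable']
  refine tsum_congr fun x => ?_
  rw [← hμ.2 k x, Measure.map_apply hm (measurableSet_singleton x)]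
  congr 2
  ext ω
  simp [funext_iff]

lemma lintegral_avoid {G : WeightedGraph V} {o : V} {μ : Measure (ℕ → V)}
    (hμ : IsRandomWalk G o μ) (z : Set V) (k : ℕ) (f : V → ℝ≥0∞) :
    ∫⁻ ω, (if ∀ j < k, ω j ∉ z then f (ω k) else 0) ∂μ = (killedStep G z)^[k] f o := by
  have hprefix : ∀ (k : ℕ) (f : V → ℝ≥0∞),
      ∫⁻ ω, (if ∀ j < k, ω j ∉ z then f (ω k) else 0) ∂μ
        = ∑' x : Fin (k + 1) → V, (if ∀ j : Fin k, x j.castSucc ∉ z then f (x (Fin.last k)) else 0)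
          * ((if x 0 = o then 1 else 0) * ∏ i : Fin k, G.trans (x i.castSucc) (x i.succ)) := by
    intro k f
    rw [← lintegral_prefix hμ k
      (fun x => if ∀ j : Fin k, x j.castSucc ∉ z then f (x (Fin.last k)) else 0)]
    refine lintegral_congr fun ω => ?_
    simp [Fin.forall_iff]
  induction k generalizing f with
  | zero =>
    rw [hprefix, ← (Equiv.funUnique (Fin 1) V).symm.tsum_eq]
    simp
  | succ k ih =>
    rw [Function.iterate_succ_apply, ← ih, hprefix, hprefix,
      ← (Fin.snocEquiv fun _ : Fin (k + 2) => V).tsum_eq, ENNReal.tsum_prod', ENNReal.tsum_comm]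
    refine tsum_congr fun x => ?_
    have h0 : ∀ y, (Fin.snoc x y : Fin (k + 2) → V) 0 = x 0 := fun y =>
      Fin.snoc_castSucc (α := fun _ : Fin (k + 2) => V) (i := (0 : Fin (k + 1))) ..
    simp only [Fin.snocEquiv_apply, Fin.prod_univ_castSucc, Fin.snoc_last, Fin.succ_last,
      Fin.succ_castSucc, Fin.snoc_castSucc, killedStep, Fin.forall_fin_succ', h0]
    by_cases hx : ∀ j : Fin k, x j.castSucc ∉ z
    · by_cases hl : x (Fin.last k) ∈ z
      · simp [hl]
      · simp only [hx, hl, not_false_eq_true, implies_true, and_self, if_true, if_false]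
        rw [← ENNReal.tsum_mul_right]
        exact tsum_congr fun y => by ring
    · simp [hx]

end PathLaw

section Energy

lemma exists_depth (G : WeightedGraph V) {o : V} {z : Set V} {m : ℕ} (h : G.distGE o z m) :
    ∃ d : V → ℕ, d o = m ∧ (∀ x, d x ≤ m) ∧ (∀ x ∈ z, d x = 0) ∧
      ∀ x y, 0 < G.w x y → d x ≤ d y + 1 := by
  let S : V → Set ℕ := fun x =>
    {k | k = m ∨ ∃ p : ℕ → V, p 0 = o ∧ (∀ i, i < k → 0 < G.w (p i) (p (i + 1))) ∧ p k = x}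
  have hS : ∀ x, sInf (S x) ∈ S x := fun x => Nat.sInf_mem ⟨m, Or.inl rfl⟩
  refine ⟨fun x => m - sInf (S x), ?_, fun x => Nat.sub_le _ _, fun x hx => ?_, fun x y hxy => ?_⟩
  · have : sInf (S o) = 0 := Nat.sInf_eq_zero.2 (Or.inl (Or.inr ⟨fun _ => o, rfl, by simp, rfl⟩))
    simp [this]
  · rcases hS x with h' | ⟨p, h0, hp, hx'⟩
    · simp [h']
    · have := h _ p h0 hp (by rw [hx']; exact hx)
      exact Nat.sub_eq_zero_of_le this
  · have hy : sInf (S y) ≤ m := Nat.sInf_le (Or.inl rfl)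
    have : sInf (S y) ≤ sInf (S x) + 1 := by
      rcases hS x with h' | ⟨p, h0, hp, hx'⟩
      · omega
      · refine Nat.sInf_le (Or.inr
          ⟨fun i => if i ≤ sInf (S x) then p i else y, by simp [h0], fun i hi => ?_, by simp⟩)
        rcases (Nat.lt_succ_iff.1 hi).lt_or_eq with hi | hi
        · simp [hi.le, Nat.succ_le_of_lt hi, hp i hi]
        · simp [hi, hx', hxy]
    show m - _ ≤ m - _ + 1
    omega

lemma tsum_tsum_le_of_add_swap_le {T E : V → V → ℝ≥0∞}
    (h : ∀ x y, T x y + T y x ≤ E x y + E y x) :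
    ∑' x, ∑' y, T x y ≤ ∑' x, ∑' y, E x y := by
  have hsymm : ∀ F : V → V → ℝ≥0∞,
      ∑' x, ∑' y, (F x y + F y x) = 2 * ∑' x, ∑' y, F x y := by
    intro F
    simp only [ENNReal.tsum_add]
    rw [ENNReal.tsum_comm (f := fun x y => F y x), two_mul]
  have := ENNReal.tsum_le_tsum fun x => ENNReal.tsum_le_tsum fun y => h x y
  rw [hsymm, hsymm] at this
  exact (ENNReal.mul_le_mul_iff_right two_ne_zero ENNReal.ofNat_ne_top).1 this

lemma tsum_tsum_ite_mem_eq_setWeight (G : WeightedGraph V) (z : Set V) (c : ℝ≥0∞) :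
    ∑' x, ∑' y, (if y ∈ z then G.w x y * c else 0) = G.setWeight z * c := by
  rw [ENNReal.tsum_comm, WeightedGraph.setWeight, ← ENNReal.tsum_mul_right,
    tsum_subtype z fun x => G.vw x * c]
  refine tsum_congr fun y => ?_
  by_cases hy : y ∈ z
  · simp only [hy, if_true, Set.indicator_of_mem]
    rw [ENNReal.tsum_mul_right, WeightedGraph.vw]
    simp only [G.symm y]
  · simp [hy]

/-- Testing a subsolution `u` of the discounted killed walk, with extra killing `a` at `o`,
against `η ^ d * u ^ (e - 1)`. -/
lemma subsolution_bound (G : WeightedGraph V) {o : V} {z : Set V} (ho : o ∉ z)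
    {s e η : ℝ} (hs0 : 0 < s) (hs1 : s < 1) (he : 1 < e) (hη : 1 ≤ η)
    (hmax : ∀ t, 0 ≤ t → t ≤ s → η * (t ^ (e - 1) * (s - t)) ≤ 1 - s * t)
    {d : V → ℕ} (hdz : ∀ x ∈ z, d x = 0) (hd : ∀ x y, 0 < G.w x y → d x ≤ d y + 1)
    (hdo : ∀ x, d x ≤ d o)
    {u : V → ℝ} (hu0 : ∀ x, 0 ≤ u x) (hu1 : ∀ x, u x ≤ 1)
    (hsum : ∑' x, G.vw x * ENNReal.ofReal (u x) ≠ ⊤) {a : ℝ≥0∞}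
    (hsub : ∀ x ∉ z, ENNReal.ofReal (u x) + (if x = o then a else 0)
      ≤ ENNReal.ofReal s * ∑' y, G.trans x y * ENNReal.ofReal (u y)) :
    G.vw o * ENNReal.ofReal (η ^ d o * u o ^ (e - 1)) * a
      ≤ G.setWeight z * ENNReal.ofReal (η * (s ^ e * ((e - 1) / e) ^ (e - 1) / e)) := by
  set ψ : V → ℝ := fun x => η ^ d x * u x ^ (e - 1) with hψ
  have hη0 : 0 < η := by linarith
  have hψ0 : ∀ x, 0 ≤ ψ x := fun x => by
    have := Real.rpow_nonneg (hu0 x) (e - 1)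
    simp only [hψ]; positivity
  set A : ℝ := η * (s ^ e * ((e - 1) / e) ^ (e - 1) / e) with hA
  have hA0 : 0 ≤ A := by
    have : 0 < e - 1 := by linarith
    have : 0 < e := by linarith
    positivity
  have hinterior : ∀ x y, 0 < G.w x y →
      s * (ψ x * u y + ψ y * u x) ≤ ψ x * u x + ψ y * u y := by
    have hle : ∀ x y, 0 < G.w x y → d y ≤ d x →
        s * (ψ x * u y + ψ y * u x) ≤ ψ x * u x + ψ y * u y := by
      intro x y hw hdxy
      have hmax1 : ∀ t, 0 ≤ t → t ≤ s → 1 * (t ^ (e - 1) * (s - t)) ≤ 1 - s * t := by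
        intro t ht hts
        have : t ^ (e - 1) ≤ 1 := Real.rpow_le_one ht (by linarith) (by linarith)
        nlinarith
      have key : ∀ c : ℝ, η ^ d x = η ^ d y * c →
          s * (c * u x ^ (e - 1) * u y + u y ^ (e - 1) * u x)
            ≤ c * u x ^ (e - 1) * u x + u y ^ (e - 1) * u y →
          s * (ψ x * u y + ψ y * u x) ≤ ψ x * u x + ψ y * u y := by
        intro c hc h
        have h' := mul_le_mul_of_nonneg_left h (pow_nonneg hη0.le (d y))
        simp only [hψ, hc]
        nlinarith
      rcases hdxy.eq_or_lt with h | h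
      · exact key 1 (by rw [h, mul_one])
          (edge_inequality_of_eq_or_succ hs0 hs1 he le_rfl hmax1 (hu0 x) (hu0 y))
      · have : d x = d y + 1 := le_antisymm (hd x y hw) h
        exact key η (by rw [this, pow_succ])
          (edge_inequality_of_eq_or_succ hs0 hs1 he hη hmax (hu0 x) (hu0 y))
    intro x y hw
    rcases le_total (d y) (d x) with h | h
    · exact hle x y hw h
    · have := hle y x (by rwa [G.symm]) h
      linarith
  have hbdry : ∀ x y, 0 < G.w x y → y ∈ z → s * (ψ x * u y) ≤ ψ x * u x + A := by
    intro x y hw hy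
    have hdx : d x ≤ 1 := by simpa [hdz y hy] using hd x y hw
    have hηd : η ^ d x ≤ η := by simpa using pow_le_pow_right₀ hη hdx
    have hM := rpow_mul_sub_le_max hs0 he (hu0 x)
    have hM0 : 0 ≤ s ^ e * ((e - 1) / e) ^ (e - 1) / e := by
      have : 0 < e - 1 := by linarith
      have : 0 < e := by linarith
      positivity
    have h1 : ψ x * (s - u x) ≤ A := by
      calc ψ x * (s - u x) = η ^ d x * (u x ^ (e - 1) * (s - u x)) := by simp only [hψ]; ring
        _ ≤ η ^ d x * (s ^ e * ((e - 1) / e) ^ (e - 1) / e) := by gcongr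
        _ ≤ A := by rw [hA]; gcongr
    have h2 : s * (ψ x * u y) ≤ s * ψ x := by
      have := mul_le_of_le_one_right (hψ0 x) (hu1 y)
      gcongr
    linarith
  let T : V → V → ℝ≥0∞ := fun x y =>
    if x ∈ z then 0 else G.w x y * ENNReal.ofReal (s * (ψ x * u y))
  let E : V → V → ℝ≥0∞ := fun x y =>
    (if x ∈ z then 0 else G.w x y * ENNReal.ofReal (ψ x * u x)) +
      (if y ∈ z then G.w x y * ENNReal.ofReal A else 0)
  have hTE : ∑' x, ∑' y, T x y ≤ ∑' x, ∑' y, E x y := by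
    refine tsum_tsum_le_of_add_swap_le fun x y => ?_
    have hb : ∀ x y, y ∈ z → G.w x y * ENNReal.ofReal (s * (ψ x * u y))
        ≤ G.w x y * ENNReal.ofReal (ψ x * u x) + G.w x y * ENNReal.ofReal A := by
      intro x y hy
      rcases (zero_le : 0 ≤ G.w x y).eq_or_lt with hw | hw
      · simp [← hw]
      · rw [← mul_add, ← ENNReal.ofReal_add (mul_nonneg (hψ0 x) (hu0 x)) hA0]
        gcongr
        exact hbdry x y hw hy
    by_cases hx : x ∈ z <;> by_cases hy : y ∈ z
    · simp [T, hx, hy]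
    · simp only [T, E, hx, hy, if_true, if_false, zero_add, add_zero]
      simpa [add_comm] using hb y x hx
    · simp only [T, E, hx, hy, if_true, if_false, add_zero]
      simpa using hb x y hy
    · simp only [T, E, hx, hy, if_false, add_zero, G.symm y x]
      rcases (zero_le : 0 ≤ G.w x y).eq_or_lt with hw | hw
      · simp [← hw]
      · have n1 := mul_nonneg (hψ0 x) (hu0 x)
        have n2 := mul_nonneg (hψ0 y) (hu0 y)
        have n3 := mul_nonneg hs0.le (mul_nonneg (hψ0 x) (hu0 y))
        have n4 := mul_nonneg hs0.le (mul_nonneg (hψ0 y) (hu0 x))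
        rw [← mul_add, ← mul_add, ← ENNReal.ofReal_add n1 n2, ← ENNReal.ofReal_add n3 n4]
        have := hinterior x y hw
        exact mul_le_mul_right (ENNReal.ofReal_le_ofReal (by linarith)) _
  have hE : ∑' x, ∑' y, E x y
      = ∑' x, (if x ∈ z then 0 else G.vw x * ENNReal.ofReal (ψ x * u x))
        + G.setWeight z * ENNReal.ofReal A := by
    simp only [E, ENNReal.tsum_add, tsum_tsum_ite_mem_eq_setWeight]
    congr 1
    refine tsum_congr fun x => ?_
    split_ifs
    · simp
    · rw [ENNReal.tsum_mul_right, WeightedGraph.vw]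
  have hfin : ∑' x, (if x ∈ z then 0 else G.vw x * ENNReal.ofReal (ψ x * u x)) ≠ ⊤ := by
    refine ne_top_of_le_ne_top
      (ENNReal.mul_ne_top (ENNReal.ofReal_ne_top (r := η ^ d o)) hsum) ?_
    rw [← ENNReal.tsum_mul_left]
    refine ENNReal.tsum_le_tsum fun x => ?_
    split_ifs
    · simp
    · have hψle : ψ x ≤ η ^ d o := by
        have h1 : u x ^ (e - 1) ≤ 1 := Real.rpow_le_one (hu0 x) (hu1 x) (by linarith)
        have h2 : η ^ d x ≤ η ^ d o := pow_le_pow_right₀ hη (hdo x)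
        have h3 := pow_pos hη0 (d x)
        simp only [hψ]
        nlinarith
      rw [ENNReal.ofReal_mul (hψ0 x), mul_left_comm]
      gcongr
  have hL : ∑' x, (if x ∈ z then 0 else G.vw x * ENNReal.ofReal (ψ x * u x))
      + G.vw o * ENNReal.ofReal (ψ o) * a ≤ ∑' x, ∑' y, T x y := by
    have ha : G.vw o * ENNReal.ofReal (ψ o) * a
        = ∑' x, if x = o then G.vw x * ENNReal.ofReal (ψ x) * a else 0 := by
      rw [tsum_ite_eq]
    rw [ha, ← ENNReal.tsum_add]
    refine ENNReal.tsum_le_tsum fun x => ?_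
    by_cases hx : x ∈ z
    · have : x ≠ o := fun h => ho (h ▸ hx)
      simp [hx, this]
    · have h := mul_le_mul_right (hsub x hx) (G.vw x * ENNReal.ofReal (ψ x))
      have hT : ∑' y, T x y = G.vw x * ENNReal.ofReal (ψ x) *
          (ENNReal.ofReal s * ∑' y, G.trans x y * ENNReal.ofReal (u y)) := by
        simp only [T, hx, if_false, ← ENNReal.tsum_mul_left]
        refine tsum_congr fun y => ?_
        rw [← vw_mul_trans, ENNReal.ofReal_mul hs0.le, ENNReal.ofReal_mul (hψ0 x)]
        ring
      rw [hT]
      refine le_trans (le_of_eq ?_) h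
      rw [ENNReal.ofReal_mul (hψ0 x)]
      split_ifs <;> ring
  exact (ENNReal.add_le_add_iff_left hfin).1 (hL.trans (hTE.trans_eq hE))

end Energy

section GreenBound

/-- Comparison of the discounted hitting weight of `z` with the discounted Green function at
`o`. -/
lemma killedGreen_rpow_le (G : WeightedGraph V) {o : V} {z : Set V} {n : ℕ}
    (hdist : G.distGE o z (n + 1)) (ho : o ∉ z) {s e η : ℝ} (hs0 : 0 < s) (hs1 : s < 1)
    (he : 1 < e) (hη : 1 ≤ η)
    (hmax : ∀ t, 0 ≤ t → t ≤ s → η * (t ^ (e - 1) * (s - t)) ≤ 1 - s * t)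
    (hW : G.setWeight z ≠ ⊤)
    (hGreen : killedGreen G z (ENNReal.ofReal s) (fun y => if y = o then 1 else 0) o ≠ ⊤) :
    (G.vw o).toReal * (η ^ n *
        (killedGreen G z (ENNReal.ofReal s) (fun y => if y ∈ z then 1 else 0) o).toReal ^ e)
      ≤ (G.setWeight z).toReal * s ^ e *
        (killedGreen G z (ENNReal.ofReal s) (fun y => if y = o then 1 else 0) o).toReal := by
  have hs1' : ENNReal.ofReal s < 1 := by simpa using hs1
  set F := killedGreen G z (ENNReal.ofReal s) (fun y => if y ∈ z then 1 else 0) with hF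
  set R := killedGreen G z (ENNReal.ofReal s) (fun y => if y = o then 1 else 0) with hR
  have hF1 : ∀ x, F x ≤ 1 := killedGreen_indicator_le_one G z hs1'.le
  have hFsum : ∑' x, G.vw x * F x ≠ ⊤ := by
    refine tsum_vw_mul_killedGreen_ne_top G z hs1' ?_
    convert hW using 1
    rw [WeightedGraph.setWeight, tsum_subtype z fun x => G.vw x]
    refine tsum_congr fun x => ?_
    by_cases hx : x ∈ z <;> simp [hx]
  have hRo : R o = 1 + ENNReal.ofReal s * killedStep G z R o := by
    rw [hR, killedGreen_eq, if_pos rfl]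
  have hγ : 0 < (R o).toReal := by
    refine ENNReal.toReal_pos ?_ hGreen
    rw [hRo]; simp
  set f := (F o).toReal with hf
  set γ := (R o).toReal with hγdef
  have hFo : F o = ENNReal.ofReal f :=
    (ENNReal.ofReal_toReal (ne_top_of_le_ne_top ENNReal.one_ne_top (hF1 o))).symm
  have hRo' : R o = ENNReal.ofReal γ := (ENNReal.ofReal_toReal hGreen).symm
  have he0 : 0 < e := by linarith
  have hf0 : 0 ≤ f := ENNReal.toReal_nonneg
  rcases hf0.eq_or_lt with hf' | hfpos
  · rw [← hf', Real.zero_rpow he0.ne']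
    simp only [mul_zero]
    positivity
  set a : ℝ≥0∞ := ENNReal.ofReal (f / (e * γ)) with ha
  have haR : a * R o = ENNReal.ofReal (f / e) := by
    rw [ha, hRo', ← ENNReal.ofReal_mul (by positivity)]
    congr 1
    field_simp
  set H : V → ℝ≥0∞ := fun x => F x - a * R x with hH
  have hHF : ∀ x, H x ≤ F x := fun x => tsub_le_self
  have hHtop : ∀ x, H x ≠ ⊤ := fun x =>
    ne_top_of_le_ne_top ENNReal.one_ne_top ((hHF x).trans (hF1 x))
  have hHreal : ∀ x, ENNReal.ofReal (H x).toReal = H x := fun x =>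
    ENNReal.ofReal_toReal (hHtop x)
  have hHo : (H o).toReal = f * ((e - 1) / e) := by
    have : H o = ENNReal.ofReal (f * ((e - 1) / e)) := by
      simp only [hH]
      rw [haR, hFo, ← ENNReal.ofReal_sub _ (by positivity)]
      congr 1
      field_simp
    rw [this, ENNReal.toReal_ofReal]
    have : 0 < e - 1 := by linarith
    positivity
  have hHsum : ∑' x, G.vw x * ENNReal.ofReal (H x).toReal ≠ ⊤ := by
    refine ne_top_of_le_ne_top hFsum (ENNReal.tsum_le_tsum fun x => ?_)
    rw [hHreal]
    gcongr
    exact hHF x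
  have hsub : ∀ x ∉ z, ENNReal.ofReal (H x).toReal + (if x = o then a else 0)
      ≤ ENNReal.ofReal s * ∑' y, G.trans x y * ENNReal.ofReal (H y).toReal := by
    intro x hx
    simp only [hHreal]
    have hstep : ∑' y, G.trans x y * H y = killedStep G z H x := by
      rw [killedStep, if_neg hx]
    rw [hstep]
    have hFx : F x ≤ ENNReal.ofReal s * killedStep G z H x
        + a * (ENNReal.ofReal s * killedStep G z R x) := by
      calc F x = ENNReal.ofReal s * killedStep G z F x := by
            rw [hF, killedGreen_eq, if_neg hx, zero_add]
        _ ≤ ENNReal.ofReal s * killedStep G z (fun y => H y + a * R y) x := by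
            gcongr
            exact killedStep_mono G z (fun y => le_tsub_add) x
        _ = _ := by
            rw [killedStep_add, killedStep_const_mul]
            ring
    split_ifs with hxo
    · subst hxo
      have hle : a * R x ≤ F x := by
        rw [haR, hFo]
        refine ENNReal.ofReal_le_ofReal ?_
        exact div_le_self hf0 he.le
      have hsum : H x + a * R x = F x := tsub_add_cancel_of_le hle
      have hfin : a * (ENNReal.ofReal s * killedStep G z R x) ≠ ⊤ := by
        refine ENNReal.mul_ne_top ENNReal.ofReal_ne_top (ne_top_of_le_ne_top hGreen ?_)
        rw [hRo]
        exact le_add_self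
      refine (ENNReal.add_le_add_iff_right hfin).1 ?_
      refine le_trans (le_of_eq ?_) hFx
      rw [← hsum, hRo]
      ring
    · rw [add_zero, hH]
      refine tsub_le_iff_right.2 (hFx.trans ?_)
      gcongr
      rw [hR, killedGreen_eq (f := fun y => if y = o then 1 else 0) (x := x)]
      exact le_add_self
  obtain ⟨d, hdo, hdm, hdz, hd⟩ := exists_depth G hdist
  have key := subsolution_bound G ho hs0 hs1 he hη hmax hdz hd (fun x => hdo ▸ hdm x)
    (u := fun x => (H x).toReal) (fun x => ENNReal.toReal_nonneg)
    (fun x => ENNReal.toReal_le_of_le_ofReal zero_le_one (by simpa using (hHF x).trans (hF1 x)))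
    hHsum hsub
  have hη0 : 0 < η := by linarith
  have he1 : 0 < e - 1 := by linarith
  have key' := ENNReal.toReal_mono (ENNReal.mul_ne_top hW ENNReal.ofReal_ne_top) key
  simp only [ENNReal.toReal_mul, hHo, hdo, ha] at key'
  rw [ENNReal.toReal_ofReal (by positivity), ENNReal.toReal_ofReal (by positivity),
    ENNReal.toReal_ofReal (by positivity), Real.mul_rpow hf0 (by positivity)] at key'
  have hfe : f ^ e = f ^ (e - 1) * f := by
    rw [← Real.rpow_add_one hfpos.ne']; congr 1; ring
  have hc : 0 < ((e - 1) / e) ^ (e - 1) := by positivity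
  set c := ((e - 1) / e) ^ (e - 1)
  have hk : 0 < η * c / (e * γ) := by positivity
  rw [hfe]
  refine le_of_mul_le_mul_right (a := η * c / (e * γ)) ?_ hk
  calc _ = (G.vw o).toReal * (η ^ (n + 1) * (f ^ (e - 1) * c)) * (f / (e * γ)) := by
        field_simp
        ring
    _ ≤ _ := key'
    _ = _ := by field_simp

end GreenBound

section HittingTime

variable {z : Set V}

lemma hitTime_le_natCast {ω : ℕ → V} {k : ℕ} (h : ω k ∈ z) : hitTime z ω ≤ k :=
  iInf₂_le k h

lemma natCast_lt_hitTime_iff {ω : ℕ → V} {k : ℕ} :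
    (k : ℝ≥0∞) < hitTime z ω ↔ ∀ j < k + 1, ω j ∉ z := by
  refine ⟨fun h j hj hz => ?_, fun h => ?_⟩
  · exact (h.trans_le (hitTime_le_natCast hz)).not_ge (by exact_mod_cast Nat.lt_succ_iff.1 hj)
  · have hk : (k : ℝ≥0∞) < (k + 1 : ℕ) := by exact_mod_cast k.lt_succ_self
    refine hk.trans_le (le_iInf₂ fun i hi => ?_)
    have : k + 1 ≤ i := by
      by_contra hlt
      exact h i (by omega) hi
    exact_mod_cast this

lemma exists_first_hit_of_hitTime_le {ω : ℕ → V} {b : ℝ} (hb : 0 ≤ b)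
    (h : hitTime z ω ≤ ENNReal.ofReal b) : ∃ k < ⌊b⌋₊ + 1, ω k ∈ z ∧ ∀ j < k, ω j ∉ z := by
  have hex : ∃ k < ⌊b⌋₊ + 1, ω k ∈ z := by
    by_contra! hne
    have hlt := (natCast_lt_hitTime_iff.2 hne).trans_le h
    have : ((⌊b⌋₊ + 1 : ℕ) : ℝ≥0∞) ≤ hitTime z ω := by
      refine le_iInf₂ fun i hi => ?_
      have : ⌊b⌋₊ + 1 ≤ i := by
        by_contra hi'
        exact hne i (by omega) hi
      exact_mod_cast this
    have h' := this.trans h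
    rw [← ENNReal.ofReal_natCast, ENNReal.ofReal_le_ofReal_iff hb] at h'
    have := Nat.lt_floor_add_one b
    push_cast at h'
    linarith
  obtain ⟨k, hk, hkz⟩ := hex
  have hex' : ∃ k, ω k ∈ z := ⟨k, hkz⟩
  exact ⟨Nat.find hex', (Nat.find_min' hex' hkz).trans_lt hk, Nat.find_spec hex',
    fun j hj => Nat.find_min hex' hj⟩

variable [Countable V] [MeasurableSpace V] [MeasurableSingletonClass V]
  {G : WeightedGraph V} {o : V} {μ : Measure (ℕ → V)}

lemma measurableSet_first_visits (z A : Set V) (k m : ℕ) :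
    MeasurableSet {ω : ℕ → V | ω k ∈ A ∧ ∀ j < m, ω j ∉ z} := by
  have : {ω : ℕ → V | ω k ∈ A ∧ ∀ j < m, ω j ∉ z}
      = (fun ω => ω k) ⁻¹' A ∩ ⋂ j < m, (fun ω => ω j) ⁻¹' zᶜ := by
    ext ω
    simp
  rw [this]
  exact (measurable_pi_apply k (MeasurableSet.of_discrete (s := A))).inter
    (MeasurableSet.iInter fun j => MeasurableSet.iInter fun _ =>
      measurable_pi_apply j (MeasurableSet.of_discrete (s := zᶜ)))

lemma killedGreen_le_lintegral_visitsBefore (hμ : IsRandomWalk G o μ) (ho : o ∉ z) {s : ℝ≥0∞}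
    (hs : s ≤ 1) :
    killedGreen G z s (fun y => if y = o then 1 else 0) o ≤ ∫⁻ ω, visitsBefore z o ω ∂μ := by
  have hmeas : ∀ k : ℕ, Measurable fun ω : ℕ → V =>
      if ω k = o ∧ (k : ℝ≥0∞) < hitTime z ω then (1 : ℝ≥0∞) else 0 := by
    intro k
    refine Measurable.ite ?_ measurable_const measurable_const
    simpa only [natCast_lt_hitTime_iff, Set.mem_singleton_iff] using
      measurableSet_first_visits z {o} k (k + 1)
  unfold visitsBefore killedGreen
  rw [lintegral_tsum fun k => (hmeas k).aemeasurable]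
  refine ENNReal.tsum_le_tsum fun k => ?_
  rw [← lintegral_avoid hμ]
  refine (mul_le_of_le_one_left zero_le (pow_le_one₀ zero_le hs)).trans
    (lintegral_mono fun ω => ?_)
  simp only [natCast_lt_hitTime_iff]
  by_cases h1 : ω k = o
  · by_cases h2 : ∀ j < k, ω j ∉ z
    · have : ∀ j < k + 1, ω j ∉ z := by
        intro j hj
        rcases (Nat.lt_succ_iff.1 hj).lt_or_eq with hj | rfl
        · exact h2 j hj
        · rwa [h1]
      rw [if_pos h2, if_pos h1, if_pos ⟨h1, this⟩]
    · rw [if_neg h2]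
      exact zero_le
  · simp [h1]

lemma measure_hitTime_le (hμ : IsRandomWalk G o μ) {s b : ℝ} (hs0 : 0 < s) (hs1 : s ≤ 1)
    (hb : 0 ≤ b) :
    μ {ω | hitTime z ω ≤ ENNReal.ofReal b} ≤ ENNReal.ofReal (s ^ (-b)) *
      killedGreen G z (ENNReal.ofReal s) (fun y => if y ∈ z then 1 else 0) o := by
  have hA : ∀ k : ℕ, μ {ω | ω k ∈ z ∧ ∀ j < k, ω j ∉ z}
      = (killedStep G z)^[k] (fun y => if y ∈ z then 1 else 0) o := by
    intro k
    rw [← lintegral_avoid hμ, ← lintegral_indicator_one (measurableSet_first_visits z z k k)]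
    refine lintegral_congr fun ω => ?_
    by_cases h1 : ω k ∈ z <;> by_cases h2 : ∀ j < k, ω j ∉ z <;>
      simp [Set.indicator, h1, h2]
  calc μ {ω | hitTime z ω ≤ ENNReal.ofReal b}
      ≤ μ (⋃ k ∈ Finset.range (⌊b⌋₊ + 1), {ω | ω k ∈ z ∧ ∀ j < k, ω j ∉ z}) := by
        refine measure_mono fun ω hω => ?_
        obtain ⟨k, hk, h⟩ := exists_first_hit_of_hitTime_le hb hω
        simp only [Set.mem_iUnion, Finset.mem_range]
        exact ⟨k, hk, h⟩
    _ ≤ ∑ k ∈ Finset.range (⌊b⌋₊ + 1), μ {ω | ω k ∈ z ∧ ∀ j < k, ω j ∉ z} :=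
        measure_biUnion_finset_le _ _
    _ ≤ ∑ k ∈ Finset.range (⌊b⌋₊ + 1), ENNReal.ofReal (s ^ (-b)) *
          (ENNReal.ofReal s ^ k *
            (killedStep G z)^[k] (fun y => if y ∈ z then 1 else 0) o) := by
        refine Finset.sum_le_sum fun k hk => ?_
        rw [hA, ← mul_assoc, ← ENNReal.ofReal_pow hs0.le,
          ← ENNReal.ofReal_mul (Real.rpow_nonneg hs0.le _), ← Real.rpow_natCast,
          ← Real.rpow_add hs0]
        refine le_mul_of_one_le_left zero_le ?_
        rw [ENNReal.one_le_ofReal]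
        refine Real.one_le_rpow_of_pos_of_le_one_of_nonpos hs0 hs1 ?_
        have : (k : ℝ) ≤ ⌊b⌋₊ := by
          exact_mod_cast Nat.lt_succ_iff.1 (Finset.mem_range.1 hk)
        linarith [Nat.floor_le hb]
    _ ≤ _ := by
        rw [← Finset.mul_sum]
        exact mul_le_mul_right (ENNReal.sum_le_tsum _) _

end HittingTime

section Parameters

lemma exists_parameters {g a : ℝ} (hg : 1 < g) (ha : 1 < a) (ha' : a < (g + 1) / (g - 1)) :
    ∃ s t e η : ℝ, 0 < s ∧ s < 1 ∧ 0 < t ∧ 1 < e ∧ 1 ≤ η ∧ η * t ^ e = g ∧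
      (∀ x, 0 ≤ x → x ≤ s → η * (x ^ (e - 1) * (s - x)) ≤ 1 - s * x) ∧
      s ^ (-a) * t
        = g / (a + 1) * (g / (a ^ 2 - 1)) ^ ((a - 1) / 2) * (2 * a / (g + 1)) ^ a := by
  have hag : a * (g - 1) < g + 1 := (lt_div_iff₀ (by linarith)).1 ha'
  have hg0 : 0 < g := by linarith
  have ha0 : 0 < a := by linarith
  have ha1 : 0 < a - 1 := by linarith
  have hq : 0 < a ^ 2 - 1 := by nlinarith
  set t := √(g * (a - 1) / (a + 1)) with ht
  have ht0 : 0 < t := Real.sqrt_pos.2 (by positivity)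
  have ht2 : t ^ 2 = g * (a - 1) / (a + 1) := Real.sq_sqrt (by positivity)
  set s := (g + 1) * (a + 1) / (2 * a * g) * t with hs
  have hs0 : 0 < s := by positivity
  have hs2 : s ^ 2 = (g + 1) ^ 2 * (a ^ 2 - 1) / (4 * a ^ 2 * g) := by
    rw [hs, mul_pow, ht2]
    field_simp
    ring
  have hs1 : s < 1 := by
    have : s ^ 2 < 1 := by
      rw [hs2, div_lt_one (by positivity)]
      nlinarith [mul_pos (sub_pos.2 hag) (by nlinarith : 0 < a * (g - 1) + (g + 1))]
    nlinarith
  have hts : t < s := by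
    rw [hs]
    refine lt_mul_of_one_lt_left ht0 ?_
    rw [one_lt_div (by positivity)]
    nlinarith
  have hst : 0 < 1 - s * t := by nlinarith
  have hd : 0 < s - t := by linarith
  have hcrit : g * (s - t) = t * (1 - s * t) := by
    have : s * (g + t ^ 2) = (g + 1) * t := by
      rw [ht2, hs]
      field_simp
      ring
    nlinarith
  set e := 1 + t * (1 - s ^ 2) / ((s - t) * (1 - s * t)) with he
  have h1s : 0 < 1 - s ^ 2 := by nlinarith
  have he1 : 1 < e := by
    have : 0 < t * (1 - s ^ 2) / ((s - t) * (1 - s * t)) := by positivity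
    linarith
  have hte : 0 < t ^ e := Real.rpow_pos_of_pos ht0 e
  have hte' : t ^ e = t ^ (e - 1) * t := by
    rw [← Real.rpow_add_one ht0.ne']
    congr 1
    ring
  have hη : g / t ^ e * (t ^ (e - 1) * (s - t)) = 1 - s * t := by
    rw [hte'] at hte ⊢
    have := Real.rpow_pos_of_pos ht0 (e - 1)
    field_simp
    linarith
  refine ⟨s, t, e, g / t ^ e, hs0, hs1, ht0, he1, ?_, div_mul_cancel₀ _ hte.ne', ?_, ?_⟩
  · rw [one_le_div hte]
    exact (Real.rpow_le_one ht0.le (by linarith) (by linarith)).trans hg.le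
  · exact fun x hx hxs => rpow_mul_sub_le hs1 ht0 hts (by rw [he]; ring) hη hx hxs
  · clear_value e s t
    have hlt : 2 * Real.log t = Real.log g + Real.log (a - 1) - Real.log (a + 1) := by
      have := Real.log_pow t 2
      rw [ht2, Real.log_div (by positivity) (by positivity),
        Real.log_mul (by positivity) (by positivity)] at this
      push_cast at this
      linarith
    have hls : Real.log s
        = Real.log (g + 1) + Real.log (a + 1) - Real.log (2 * a) - Real.log g + Real.log t := by
      rw [hs, Real.log_mul (by positivity) (by positivity),
        Real.log_div (by positivity) (by positivity),
        Real.log_mul (by positivity) (by positivity),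
        Real.log_mul (by positivity) (by positivity)]
      ring
    have hlq : Real.log (a ^ 2 - 1) = Real.log (a - 1) + Real.log (a + 1) := by
      rw [← Real.log_mul (by positivity) (by positivity)]
      congr 1
      ring
    refine Real.log_injOn_pos (Set.mem_Ioi.2 (by positivity)) (Set.mem_Ioi.2 (by positivity)) ?_
    rw [Real.log_mul (by positivity) (by positivity), Real.log_rpow hs0,
      Real.log_mul (by positivity) (by positivity), Real.log_mul (by positivity) (by positivity),
      Real.log_rpow (by positivity), Real.log_rpow (by positivity),
      Real.log_div (by positivity) (by positivity), Real.log_div (by positivity) (by positivity),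
      Real.log_div (by positivity) (by positivity), hlq, hls]
    have : Real.log t = (Real.log g + Real.log (a - 1) - Real.log (a + 1)) / 2 := by linarith
    rw [this]
    ring

end Parameters

/-- With `g = (w_z r_{oz})^{1/n} > 1` and `1 < a < (g+1)/(g-1)`, one has
`P(T_{oz} ≤ an+1) ≤ e^{-I_g(a) n}`. -/
theorem hitting_time_large_deviation_bound_resistance
    {V : Type*} [Countable V] [MeasurableSpace V] [MeasurableSingletonClass V]
    (G : WeightedGraph V) (o : V) (z : Set V) (n : ℕ) (hn : 1 ≤ n) (g a : ℝ)
    (μ : Measure (ℕ → V)) (hμ : IsRandomWalk G o μ)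
    (hdist : G.distGE o z (n + 1))
    (hgdef : ENNReal.ofReal g = (G.setWeight z * resistance G o z μ) ^ ((n : ℝ)⁻¹))
    (hg : 1 < g)
    (ha : 1 < a) (ha' : a < (g + 1) / (g - 1)) :
    μ {ω | hitTime z ω ≤ ENNReal.ofReal (a * n + 1)}
      ≤ ENNReal.ofReal
          ((g / (a + 1) * (g / (a ^ 2 - 1)) ^ ((a - 1) / 2) * (2 * a / (g + 1)) ^ a) ^ n) := by
  have hn0 : n ≠ 0 := by omega
  have ho : o ∉ z := fun h => by
    have := hdist 0 (fun _ => o) rfl (by simp) h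
    omega
  have hWρ : G.setWeight z * resistance G o z μ = ENNReal.ofReal (g ^ n) := by
    rw [ENNReal.ofReal_pow (by linarith), hgdef, ← ENNReal.rpow_natCast, ← ENNReal.rpow_mul,
      inv_mul_cancel₀ (by exact_mod_cast hn0), ENNReal.rpow_one]
  have hne : G.setWeight z * resistance G o z μ ≠ 0 := by
    rw [hWρ, Ne, ENNReal.ofReal_eq_zero, not_le]
    positivity
  have htop : G.setWeight z * resistance G o z μ ≠ ⊤ := hWρ ▸ ENNReal.ofReal_ne_top
  have hW : G.setWeight z ≠ ⊤ := fun h =>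
    htop (by rw [h, ENNReal.top_mul (right_ne_zero_of_mul hne)])
  have hρ : resistance G o z μ ≠ ⊤ := fun h =>
    htop (by rw [h, ENNReal.mul_top (left_ne_zero_of_mul hne)])
  have hWρ' : (G.setWeight z).toReal * (resistance G o z μ).toReal = g ^ n := by
    rw [← ENNReal.toReal_mul, hWρ, ENNReal.toReal_ofReal (by positivity)]
  obtain ⟨s, t, e, η, hs0, hs1, ht0, he, hη, hηt, hmax, hrate⟩ := exists_parameters hg ha ha'
  have hs1' : ENNReal.ofReal s ≤ 1 := by simpa using hs1.le
  have hvis : G.vw o * resistance G o z μ = ∫⁻ ω, visitsBefore z o ω ∂μ :=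
    ENNReal.mul_div_cancel (vw_ne_zero G o) (vw_ne_top G o)
  have hGreen := killedGreen_le_lintegral_visitsBefore hμ ho hs1'
  rw [← hvis] at hGreen
  have hvρ := ENNReal.mul_ne_top (vw_ne_top G o) hρ
  have hbound := killedGreen_rpow_le G hdist ho hs0 hs1 he hη hmax hW
    (ne_top_of_le_ne_top hvρ hGreen)
  have hGreen' := ENNReal.toReal_mono hvρ hGreen
  rw [ENNReal.toReal_mul] at hGreen'
  have hF1 := killedGreen_indicator_le_one G z hs1' o
  have hchernoff := measure_hitTime_le (z := z) hμ hs0 hs1.le (b := a * n + 1) (by positivity)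
  set F := killedGreen G z (ENNReal.ofReal s) (fun y => if y ∈ z then 1 else 0) o
  set v := (G.vw o).toReal
  have hv : 0 < v := ENNReal.toReal_pos (vw_ne_zero G o) (vw_ne_top G o)
  have hη0 : 0 < η := by linarith
  have hse : 0 < s ^ e := Real.rpow_pos_of_pos hs0 e
  have hFe : F.toReal ^ e ≤ (s * t ^ n) ^ e := by
    refine le_of_mul_le_mul_left ?_ (mul_pos hv (pow_pos hη0 n))
    calc v * η ^ n * F.toReal ^ e
        ≤ (G.setWeight z).toReal * s ^ e * (v * (resistance G o z μ).toReal) := by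
          rw [mul_assoc]
          exact hbound.trans (mul_le_mul_of_nonneg_left hGreen' (by positivity))
      _ = v * s ^ e * g ^ n := by rw [← hWρ']; ring
      _ = v * η ^ n * (s * t ^ n) ^ e := by
          rw [← hηt, Real.mul_rpow hs0.le (by positivity), ← Real.rpow_pow_comm ht0.le]
          ring
  have hF : F.toReal ≤ s * t ^ n :=
    (Real.rpow_le_rpow_iff ENNReal.toReal_nonneg (by positivity) (by linarith)).1 hFe
  refine hchernoff.trans ?_
  rw [← ENNReal.ofReal_toReal (ne_top_of_le_ne_top ENNReal.one_ne_top hF1),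
    ← ENNReal.ofReal_mul (by positivity), ← hrate]
  refine ENNReal.ofReal_le_ofReal ?_
  calc s ^ (-(a * n + 1)) * F.toReal ≤ s ^ (-(a * n + 1)) * (s * t ^ n) := by gcongr
    _ = (s ^ (-a) * t) ^ n := by
        rw [mul_pow, ← Real.rpow_mul_natCast hs0.le, ← mul_assoc, ← Real.rpow_add_one hs0.ne']
        congr 2
        ring

end RWHitting
end

section
/- Let G=(V,w) be a weighted graph, o a vertex and z a set of vertices with dist(o,z) ≥ n+1 for an integer n ≥ 0, and let g > 1 be a solution of (g−1)² g^{n−2} = 2 w_z/w_o. Then for every λ ≥ 0, E[e^{−λ(T'_{0n}+1)}] ≥ E[e^{−λ T_{oz}}], where T'_{0n} is the hitting time of n from 0 for biased simple random walk on ℤ with odds 1:g of going left/right. -/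
open MeasureTheory Filter
open scoped Classical ENNReal

namespace RWHitting

variable {V : Type*}

section Entropy

/-- Tangent plane inequality for the jointly convex function `(x - y) * log (x / y)`. -/
lemma tangent_le_sub_mul_log_sub {x y A B : ℝ} (hx : 0 < x) (hy : 0 < y) (hA : 0 < A)
    (hB : 0 < B) :
    x * (Real.log (A / B) + 1 - B / A) + y * (1 - A / B - Real.log (A / B))
      ≤ (x - y) * (Real.log x - Real.log y) := by
  have h1 := Real.log_le_sub_one_of_pos (x := y * A / (x * B)) (by positivity)
  have h2 := Real.log_le_sub_one_of_pos (x := x * B / (y * A)) (by positivity)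
  rw [Real.log_div (by positivity) (by positivity), Real.log_mul hy.ne' hA.ne',
    Real.log_mul hx.ne' hB.ne'] at h1
  rw [Real.log_div (by positivity) (by positivity), Real.log_mul hy.ne' hA.ne',
    Real.log_mul hx.ne' hB.ne'] at h2
  rw [Real.log_div hA.ne' hB.ne']
  have h3 := mul_le_mul_of_nonneg_left h1 hx.le
  have h4 := mul_le_mul_of_nonneg_left h2 hy.le
  have e1 : x * (y * A / (x * B) - 1) = y * (A / B) - x := by field_simp
  have e2 : y * (x * B / (y * A) - 1) = x * (B / A) - y := by field_simp
  rw [e1] at h3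
  rw [e2] at h4
  linarith

lemma sum_sum_eq_zero_of_antisymm {ι : Type*} [Fintype ι] (a : ι → ι → ℝ)
    (h : ∀ x y, a y x = -a x y) : ∑ x, ∑ y, a x y = 0 := by
  have h1 : ∑ x, ∑ y, a x y = ∑ x, ∑ y, a y x := Finset.sum_comm
  have h2 : ∑ x, ∑ y, a y x = -∑ x, ∑ y, a x y := by
    simp only [← Finset.sum_neg_distrib]
    exact Finset.sum_congr rfl fun x _ => Finset.sum_congr rfl fun y _ => h x y
  linarith

variable {ι : Type*}

/-- The weights of the edges leading from level `k` to level `k + 1`. -/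
noncomputable def cut (c : ι → ι → ℝ) (l : ι → ℕ) (k : ℕ) (x y : ι) : ℝ :=
  if k = l x then (if l y = l x + 1 then c x y else 0) else 0

lemma cut_nonneg {c : ι → ι → ℝ} (hc : ∀ x y, 0 ≤ c x y) (l : ι → ℕ) (k : ℕ) (x y : ι) :
    0 ≤ cut c l k x y := by
  unfold cut; split_ifs <;> simp [hc]

lemma ne_zero_of_cut_ne_zero {c : ι → ι → ℝ} {l : ι → ℕ} {k : ℕ} {x y : ι}
    (h : cut c l k x y ≠ 0) : c x y ≠ 0 := by
  unfold cut at h; split_ifs at h <;> simp_all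

lemma sum_cut_add_cut_le {c : ι → ι → ℝ} (hc : ∀ x y, 0 ≤ c x y) (hs : ∀ x y, c x y = c y x)
    (l : ι → ℕ) (s : Finset ℕ) (x y : ι) :
    ∑ k ∈ s, (cut c l k x y + cut c l k y x) ≤ c x y := by
  have := hc x y
  rw [Finset.sum_add_distrib]
  simp only [cut, Finset.sum_ite_eq', hs y x]
  split_ifs <;> first | omega | linarith

variable [Fintype ι]

lemma cut_flow {c : ι → ι → ℝ} {b v : ι → ℝ} {l : ι → ℕ} {o : ι} {n k : ℕ}
    (hs : ∀ x y, c x y = c y x) (ho : l o = 0)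
    (hstep : ∀ x y, c x y ≠ 0 → l y ≤ l x + 1) (hb : ∀ x, b x ≠ 0 → l x = n)
    (hharm : ∀ x, ∑ y, c x y * (v x - v y) + b x * v x = if x = o then 1 else 0) (hk : k < n) :
    ∑ x, ∑ y, cut c l k x y * v x = ∑ x, ∑ y, cut c l k x y * v y + 1 := by
  have h1 : ∑ x, (if l x ≤ k then ∑ y, c x y * (v x - v y) + b x * v x else 0) = 1 := by
    simp only [hharm]
    rw [Finset.sum_eq_single o] <;> simp +contextual [ho]
  have h2 : ∑ x, ∑ y, (if l x ≤ k ∧ l y ≤ k then c x y * (v x - v y) else 0) = 0 := by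
    apply sum_sum_eq_zero_of_antisymm
    intro x y
    rw [hs y x]
    by_cases h : l x ≤ k ∧ l y ≤ k
    · rw [if_pos h, if_pos h.symm]; ring
    · rw [if_neg h, if_neg (fun h' => h h'.symm)]; ring
  have h3 : ∀ x, (if l x ≤ k then ∑ y, c x y * (v x - v y) + b x * v x else 0)
      = ∑ y, (if l x ≤ k ∧ l y ≤ k then c x y * (v x - v y) else 0)
        + (∑ y, cut c l k x y * v x - ∑ y, cut c l k x y * v y) := by
    intro x
    rw [← Finset.sum_sub_distrib, ← Finset.sum_add_distrib]
    by_cases h : l x ≤ k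
    · have hbx : b x = 0 := by
        by_contra h'
        have := hb x h'
        omega
      rw [if_pos h, hbx, zero_mul, add_zero]
      refine Finset.sum_congr rfl fun y _ => ?_
      by_cases hcxy : c x y = 0
      · simp [cut, hcxy]
      · have h4 := hstep x y hcxy
        unfold cut
        split_ifs <;> first | omega | ring
    · rw [if_neg h]
      symm
      refine Finset.sum_eq_zero fun y _ => ?_
      unfold cut
      split_ifs <;> first | omega | simp
  rw [Finset.sum_congr rfl fun x _ => h3 x, Finset.sum_add_distrib, h2,
    Finset.sum_sub_distrib] at h1
  linarith

lemma eq_zero_of_adj_eq_zero {c : ι → ι → ℝ} {b v : ι → ℝ} {o : ι}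
    (hc : ∀ x y, 0 ≤ c x y) (hv : ∀ x, 0 ≤ v x)
    (hharm : ∀ x, ∑ y, c x y * (v x - v y) + b x * v x = if x = o then 1 else 0)
    {x y : ι} (hxy : c x y ≠ 0) (hx : v x = 0) : v y = 0 := by
  have h := hharm x
  rw [hx] at h
  simp only [zero_sub, mul_neg, Finset.sum_neg_distrib, mul_zero, add_zero] at h
  have h1 : 0 ≤ ∑ y, c x y * v y := Finset.sum_nonneg fun y _ => mul_nonneg (hc x y) (hv y)
  have h2 : ∑ y, c x y * v y = 0 := by split_ifs at h <;> linarith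
  rw [Finset.sum_eq_zero_iff_of_nonneg fun y _ => mul_nonneg (hc x y) (hv y)] at h2
  exact (mul_eq_zero.mp (h2 y (Finset.mem_univ y))).resolve_left hxy

/-- Log-sum inequality for weights `e` and values `v` with `v x` and `v y` vanishing together
on the support of `e`. -/
lemma log_div_le_sum {e : ι → ι → ℝ} {v : ι → ℝ} (he : ∀ x y, 0 ≤ e x y) (hv : ∀ x, 0 ≤ v x)
    (hz : ∀ x y, e x y ≠ 0 → (v x = 0 ↔ v y = 0)) {A B : ℝ} (hA : 0 < A) (hB : 0 < B)
    (hAe : ∑ x, ∑ y, e x y * v x = A) (hBe : ∑ x, ∑ y, e x y * v y = B) :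
    (A - B) * Real.log (A / B)
      ≤ ∑ x, ∑ y, e x y * ((v x - v y) * (Real.log (v x) - Real.log (v y))) := by
  set p := Real.log (A / B) + 1 - B / A
  set q := 1 - A / B - Real.log (A / B)
  have h1 : (A - B) * Real.log (A / B) = ∑ x, ∑ y, e x y * (v x * p + v y * q) := by
    have : ∑ x, ∑ y, e x y * (v x * p + v y * q)
        = (∑ x, ∑ y, e x y * v x) * p + (∑ x, ∑ y, e x y * v y) * q := by
      simp only [Finset.sum_mul, ← Finset.sum_add_distrib]
      refine Finset.sum_congr rfl fun x _ => Finset.sum_congr rfl fun y _ => by ring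
    rw [this, hAe, hBe]
    simp only [p, q]
    field_simp
    ring
  rw [h1]
  refine Finset.sum_le_sum fun x _ => Finset.sum_le_sum fun y _ => ?_
  by_cases h : e x y = 0
  · simp [h]
  · refine mul_le_mul_of_nonneg_left ?_ (he x y)
    by_cases hx : v x = 0
    · simp [hx, (hz x y h).1 hx]
    · have hy : v y ≠ 0 := fun hy => hx ((hz x y h).2 hy)
      exact tangent_le_sub_mul_log_sub ((hv x).lt_of_ne' hx) ((hv y).lt_of_ne' hy) hA hB

lemma neg_log_le_sum_mul_log {b v : ι → ℝ} (hb : ∀ x, 0 ≤ b x) (hv : ∀ x, 0 ≤ v x) {W : ℝ}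
    (hW : 0 < W) (hbW : ∑ x, b x ≤ W) (h1 : ∑ x, b x * v x = 1) :
    -Real.log W ≤ ∑ x, b x * v x * Real.log (v x) := by
  have key : ∀ x, b x * v x * (-Real.log W) + b x * v x - b x * (1 / W)
      ≤ b x * v x * Real.log (v x) := by
    intro x
    rcases (hv x).eq_or_lt with hx | hx
    · rw [← hx]; have := hb x; simp; positivity
    · have h := Real.log_le_sub_one_of_pos (x := 1 / (W * v x)) (by positivity)
      rw [Real.log_div one_ne_zero (by positivity), Real.log_mul hW.ne' hx.ne', Real.log_one] at h
      have h2 := mul_le_mul_of_nonneg_left h (mul_nonneg (hb x) hx.le)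
      have e1 : b x * v x * (1 / (W * v x) - 1) = b x * (1 / W) - b x * v x := by field_simp
      rw [e1] at h2
      linarith
  have h2 := Finset.sum_le_sum fun x (_ : x ∈ Finset.univ) => key x
  rw [Finset.sum_sub_distrib, Finset.sum_add_distrib, ← Finset.sum_mul, ← Finset.sum_mul, h1] at h2
  have h3 : (∑ x, b x) * (1 / W) ≤ 1 := by
    rw [mul_one_div, div_le_one hW]; exact hbW
  linarith

/-- Cut-wise entropy bound for a unit flow with potential `v`. -/
lemma sum_log_cut_le {c : ι → ι → ℝ} {b v : ι → ℝ} {l : ι → ℕ} {o : ι} {n : ℕ} {W : ℝ}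
    (hc : ∀ x y, 0 ≤ c x y) (hs : ∀ x y, c x y = c y x) (hb0 : ∀ x, 0 ≤ b x)
    (hv : ∀ x, 0 ≤ v x) (ho : l o = 0)
    (hstep : ∀ x y, c x y ≠ 0 → l y ≤ l x + 1) (hb : ∀ x, b x ≠ 0 → l x = n)
    (hharm : ∀ x, ∑ y, c x y * (v x - v y) + b x * v x = if x = o then 1 else 0)
    (hW : 0 < W) (hbW : ∑ x, b x ≤ W)
    (hB : ∀ k < n, 0 < ∑ x, ∑ y, cut c l k x y * v y) (hbv : ∑ x, b x * v x = 1) :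
    ∑ k ∈ Finset.range n, Real.log (1 + 1 / ∑ x, ∑ y, cut c l k x y * v y)
      ≤ Real.log (v o) + Real.log W := by
  set G : ι → ι → ℝ := fun x y => (v x - v y) * (Real.log (v x) - Real.log (v y)) with hG
  have hGs : ∀ x y, G y x = G x y := fun x y => by simp only [hG]; ring
  have hz : ∀ x y, c x y ≠ 0 → (v x = 0 ↔ v y = 0) := fun x y h =>
    ⟨eq_zero_of_adj_eq_zero hc hv hharm h, eq_zero_of_adj_eq_zero hc hv hharm (hs x y ▸ h)⟩
  have hG0 : ∀ x y, c x y ≠ 0 → 0 ≤ G x y := by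
    intro x y h
    simp only [hG]
    by_cases hx : v x = 0
    · simp [hx, (hz x y h).1 hx]
    · have hx' := (hv x).lt_of_ne' hx
      have hy' := (hv y).lt_of_ne' fun hy => hx ((hz x y h).2 hy)
      rcases le_total (v x) (v y) with h' | h'
      · exact mul_nonneg_of_nonpos_of_nonpos (by linarith)
          (by linarith [Real.log_le_log hx' h'])
      · exact mul_nonneg (by linarith) (by linarith [Real.log_le_log hy' h'])
  have h1 : ∑ x, ∑ y, c x y * (v x - v y) * Real.log (v x)
      + ∑ x, b x * v x * Real.log (v x) = Real.log (v o) := by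
    rw [← Finset.sum_add_distrib]
    have : ∀ x, ∑ y, c x y * (v x - v y) * Real.log (v x) + b x * v x * Real.log (v x)
        = if x = o then Real.log (v o) else 0 := by
      intro x
      rw [← Finset.sum_mul, ← add_mul, hharm x]
      split_ifs with h <;> simp [h]
    simp [this]
  have h2 : 2 * ∑ x, ∑ y, c x y * (v x - v y) * Real.log (v x) = ∑ x, ∑ y, c x y * G x y := by
    have e1 : ∑ x, ∑ y, c x y * (v x - v y) * Real.log (v x)
        = ∑ x, ∑ y, c y x * (v y - v x) * Real.log (v y) := Finset.sum_comm
    rw [two_mul]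
    nth_rewrite 2 [e1]
    simp only [← Finset.sum_add_distrib, hG]
    refine Finset.sum_congr rfl fun x _ => Finset.sum_congr rfl fun y _ => ?_
    rw [hs y x]; ring
  have h3 : 2 * ∑ k ∈ Finset.range n, ∑ x, ∑ y, cut c l k x y * G x y
      ≤ ∑ x, ∑ y, c x y * G x y := by
    have e1 : 2 * ∑ k ∈ Finset.range n, ∑ x, ∑ y, cut c l k x y * G x y
        = ∑ x, ∑ y, ∑ k ∈ Finset.range n, (cut c l k x y + cut c l k y x) * G x y := by
      have e2 : ∑ k ∈ Finset.range n, ∑ x, ∑ y, cut c l k x y * G x y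
          = ∑ k ∈ Finset.range n, ∑ x, ∑ y, cut c l k y x * G x y := by
        refine Finset.sum_congr rfl fun k _ => ?_
        rw [Finset.sum_comm]
        simp only [hGs]
      rw [two_mul]
      nth_rewrite 2 [e2]
      simp only [add_mul, Finset.sum_add_distrib]
      congr 1 <;>
      · rw [Finset.sum_comm]
        refine Finset.sum_congr rfl fun x _ => Finset.sum_comm
    rw [e1]
    refine Finset.sum_le_sum fun x _ => Finset.sum_le_sum fun y _ => ?_
    rw [← Finset.sum_mul]
    by_cases h : c x y = 0
    · have h' : c y x = 0 := hs x y ▸ h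
      simp [cut, h, h']
    · exact mul_le_mul_of_nonneg_right (sum_cut_add_cut_le hc hs l _ x y) (hG0 x y h)
  have h4 : ∑ k ∈ Finset.range n, Real.log (1 + 1 / ∑ x, ∑ y, cut c l k x y * v y)
      ≤ ∑ k ∈ Finset.range n, ∑ x, ∑ y, cut c l k x y * G x y := by
    refine Finset.sum_le_sum fun k hk => ?_
    have hk' := Finset.mem_range.mp hk
    have hBk := hB k hk'
    have hA := cut_flow (v := v) hs ho hstep hb hharm hk'
    have h := log_div_le_sum (cut_nonneg hc l k) hv
      (fun x y h => hz x y (ne_zero_of_cut_ne_zero h)) (by rw [hA]; linarith) hBk rfl rfl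
    rw [hA, add_sub_cancel_left, one_mul, add_div, div_self hBk.ne'] at h
    exact h
  have h5 := neg_log_le_sum_mul_log hb0 hv hW hbW hbv
  linarith

/-- Lower bound for the expected hitting time of the ground by a walk on the finite network
with conductances `c` and conductances `b` to the ground, `v` being the voltage. -/
lemma hitting_lower_bound {c : ι → ι → ℝ} {b v : ι → ℝ} {l : ι → ℕ} {o : ι} {n : ℕ} {g W : ℝ}
    (hc : ∀ x y, 0 ≤ c x y) (hs : ∀ x y, c x y = c y x) (hb0 : ∀ x, 0 ≤ b x)
    (hv : ∀ x, 0 ≤ v x) (hn : 1 ≤ n) (hl : ∀ x, l x = 0 ↔ x = o)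
    (hstep : ∀ x y, c x y ≠ 0 → l y ≤ l x + 1) (hb : ∀ x, b x ≠ 0 → l x = n)
    (hharm : ∀ x, ∑ y, c x y * (v x - v y) + b x * v x = if x = o then 1 else 0)
    (hg : 1 < g) (hW : 0 < W) (hbW : ∑ x, b x ≤ W)
    (hsol : 2 * W ≤ (g - 1) ^ 2 * g ^ ((n : ℝ) - 2) * ∑ y, c o y) :
    1 + n * ((g + 1) / (g - 1)) ≤ ∑ x, (∑ y, c x y + b x) * v x := by
  have ho : l o = 0 := (hl o).2 rfl
  set A : ℕ → ℝ := fun k => ∑ x, ∑ y, cut c l k x y * v x with hAdef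
  set B : ℕ → ℝ := fun k => ∑ x, ∑ y, cut c l k x y * v y with hBdef
  have hAB : ∀ k < n, A k = B k + 1 := fun k hk => cut_flow hs ho hstep hb hharm hk
  have hB0 : ∀ k, 0 ≤ B k := fun k => Finset.sum_nonneg fun x _ => Finset.sum_nonneg fun y _ =>
    mul_nonneg (cut_nonneg hc l k x y) (hv y)
  have hBpos : ∀ k < n, 0 < B k := by
    intro k hk
    refine (hB0 k).lt_of_ne' fun h => ?_
    have hA0 : A k = 0 := by
      refine Finset.sum_eq_zero fun x _ => Finset.sum_eq_zero fun y _ => ?_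
      have h1 : cut c l k x y * v y = 0 := by
        have h2 := (Finset.sum_eq_zero_iff_of_nonneg fun x _ => Finset.sum_nonneg fun y _ =>
          mul_nonneg (cut_nonneg hc l k x y) (hv y)).1 h x (Finset.mem_univ x)
        exact (Finset.sum_eq_zero_iff_of_nonneg fun y _ =>
          mul_nonneg (cut_nonneg hc l k x y) (hv y)).1 h2 y (Finset.mem_univ y)
      by_cases h3 : cut c l k x y = 0
      · simp [h3]
      · have h4 := (mul_eq_zero.mp h1).resolve_left h3
        rw [eq_zero_of_adj_eq_zero hc hv hharm (hs x y ▸ ne_zero_of_cut_ne_zero h3) h4, mul_zero]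
    have := hAB k hk
    linarith
  have hbv : ∑ x, b x * v x = 1 := by
    have h1 : ∑ x, (∑ y, c x y * (v x - v y) + b x * v x) = 1 := by simp [hharm]
    rw [Finset.sum_add_distrib, sum_sum_eq_zero_of_antisymm] at h1
    · linarith
    · intro x y; rw [hs y x]; ring
  have hent := sum_log_cut_le hc hs hb0 hv ho hstep hb hharm hW hbW hBpos hbv
  change ∑ k ∈ Finset.range n, Real.log (1 + 1 / B k) ≤ _ at hent
  set C := ∑ y, c o y with hC
  -- the first level consists of `o` alone
  have hcut0 : ∀ x y, cut c l 0 x y = if x = o then cut c l 0 o y else 0 := by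
    intro x y
    split_ifs with h
    · rw [h]
    · have : (0 : ℕ) ≠ l x := fun h' => h ((hl x).1 h'.symm)
      simp [cut, this]
  set W0 := ∑ y, cut c l 0 o y with hW0
  have hA0 : A 0 = W0 * v o := by
    simp only [hAdef]
    rw [Finset.sum_eq_single o, Finset.sum_mul]
    · intro x _ hx
      refine Finset.sum_eq_zero fun y _ => ?_
      rw [hcut0, if_neg hx, zero_mul]
    · simp
  have hWC : W0 ≤ C := by
    refine Finset.sum_le_sum fun y _ => ?_
    have := hc o y
    unfold cut
    split_ifs <;> linarith
  have hAB0 := hAB 0 hn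
  have hBp0 := hBpos 0 hn
  have hvo : 0 < v o := by
    refine (hv o).lt_of_ne' fun h => ?_
    rw [h, mul_zero] at hA0
    linarith
  have hW0pos : 0 < W0 := by
    by_contra h
    have := mul_nonpos_of_nonpos_of_nonneg (not_lt.1 h) hvo.le
    linarith
  have hCpos : 0 < C := hW0pos.trans_le hWC
  set X := C * v o - 1 with hX
  have hXB : B 0 ≤ X := by
    have := mul_le_mul_of_nonneg_right hWC hvo.le
    linarith
  have hXpos : 0 < X := hBp0.trans_le hXB
  -- total time
  have htime : C * v o + B 0 + ∑ k ∈ Finset.Ico 1 n, (A k + B k) ≤ ∑ x, ∑ y, c x y * v x := by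
    have e1 : ∀ k, B k = ∑ x, ∑ y, cut c l k y x * v x := fun k => Finset.sum_comm
    have e2 : C * v o = ∑ x, ∑ y, (if x = o then c x y else 0) * v x := by
      rw [Finset.sum_eq_single o]
      · simp [hC, Finset.sum_mul]
      · intro x _ hx; simp [hx]
      · simp
    have e3 : ∑ k ∈ Finset.Ico 1 n, (A k + B k)
        = ∑ x, ∑ y, (∑ k ∈ Finset.Ico 1 n, (cut c l k x y + cut c l k y x)) * v x := by
      simp only [e1, hAdef, ← Finset.sum_add_distrib, ← add_mul]
      rw [Finset.sum_comm]
      refine Finset.sum_congr rfl fun x _ => ?_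
      rw [Finset.sum_comm]
      simp only [Finset.sum_mul]
    rw [e3, e2, e1 0]
    simp only [← Finset.sum_add_distrib]
    refine Finset.sum_le_sum fun x _ => Finset.sum_le_sum fun y _ => ?_
    rw [← add_mul, ← add_mul]
    refine mul_le_mul_of_nonneg_right ?_ (hv x)
    have hcxy := hc x y
    have hlx := hl x
    rw [Finset.sum_add_distrib]
    simp only [cut, Finset.sum_ite_eq', Finset.mem_Ico, hs y x]
    by_cases hxo : x = o
    · have := hlx.2 hxo
      simp only [hxo, if_true, ho]
      simp
    · have : l x ≠ 0 := fun h => hxo (hlx.1 h)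
      simp only [hxo, if_false]
      split_ifs <;> first | omega | linarith
  have hsumAB : ∑ k ∈ Finset.Ico 1 n, (A k + B k)
      = 2 * ∑ k ∈ Finset.Ico 1 n, B k + (n - 1) := by
    have : ∀ k ∈ Finset.Ico 1 n, A k + B k = 2 * B k + 1 := fun k hk => by
      rw [hAB k (Finset.mem_Ico.1 hk).2]; ring
    rw [Finset.sum_congr rfl this, Finset.sum_add_distrib, ← Finset.mul_sum]
    simp [Nat.cast_sub hn]
  have htot : ∑ x, (∑ y, c x y + b x) * v x = ∑ x, ∑ y, c x y * v x + 1 := by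
    simp only [add_mul, Finset.sum_add_distrib, hbv, Finset.sum_mul]
  -- the entropy inequality
  have hlogX : ∑ k ∈ Finset.Ico 1 n, Real.log (1 + 1 / B k) ≤
      Real.log (X / 2) + 2 * Real.log (g - 1) + ((n : ℝ) - 2) * Real.log g := by
    have e1 : ∑ k ∈ Finset.range n, Real.log (1 + 1 / B k)
        = Real.log (1 + 1 / B 0) + ∑ k ∈ Finset.Ico 1 n, Real.log (1 + 1 / B k) := by
      rw [Finset.range_eq_Ico, Finset.sum_eq_sum_Ico_succ_bot (by omega)]
    have e2 : Real.log (C * v o / X) ≤ Real.log (1 + 1 / B 0) := by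
      refine Real.log_le_log (by positivity) ?_
      rw [show C * v o = X + 1 by simp [hX], add_div, div_self hXpos.ne']
      gcongr
    rw [Real.log_div (by positivity) hXpos.ne', Real.log_mul hCpos.ne' hvo.ne'] at e2
    have e3 : Real.log (2 * W) ≤ Real.log ((g - 1) ^ 2 * g ^ ((n : ℝ) - 2) * C) :=
      Real.log_le_log (by positivity) hsol
    have hg1 : g - 1 ≠ 0 := by linarith
    have hg0 : 0 < g := by linarith
    rw [Real.log_mul two_ne_zero hW.ne', Real.log_mul (by positivity) hCpos.ne',
      Real.log_mul (by positivity) (by positivity), Real.log_pow, Real.log_rpow hg0] at e3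
    rw [Real.log_div hXpos.ne' two_ne_zero]
    push_cast at e3
    linarith
  have hg1 : 0 < g - 1 := by linarith
  have hg0 : 0 < g := by linarith
  set κ := (g - 1) ^ 2 / g with hκ
  have hκpos : 0 < κ := by positivity
  have htan : ∀ k ∈ Finset.Ico 1 n,
      Real.log g - κ * (B k - 1 / (g - 1)) ≤ Real.log (1 + 1 / B k) := by
    intro k hk
    have hk := hBpos k (Finset.mem_Ico.1 hk).2
    -- `log ((1 + β) / β)` is convex in `β`
    have h1 := Real.log_le_sub_one_of_pos (x := g * B k / (1 + B k)) (by positivity)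
    rw [Real.log_div (by positivity) (by positivity), Real.log_mul hg0.ne' hk.ne'] at h1
    have h2 : Real.log (1 + 1 / B k) = Real.log (1 + B k) - Real.log (B k) := by
      rw [← Real.log_div (by positivity) hk.ne']
      congr 1
      field_simp
      ring
    have h3 : g * B k / (1 + B k) - 1 ≤ κ * (B k - 1 / (g - 1)) := by
      have : κ * (B k - 1 / (g - 1)) - (g * B k / (1 + B k) - 1)
          = ((g - 1) * B k - 1) ^ 2 / (g * (1 + B k)) := by
        simp only [hκ]
        field_simp
        ring
      have h4 : 0 ≤ ((g - 1) * B k - 1) ^ 2 / (g * (1 + B k)) := by positivity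
      linarith
    linarith
  have hsum := Finset.sum_le_sum htan
  have hcard : ∑ k ∈ Finset.Ico 1 n, (Real.log g - κ * (B k - 1 / (g - 1)))
      = (n - 1) * Real.log g - κ * (∑ k ∈ Finset.Ico 1 n, B k - (n - 1) * (1 / (g - 1))) := by
    rw [Finset.sum_sub_distrib, ← Finset.mul_sum, Finset.sum_sub_distrib]
    simp [Nat.cast_sub hn]
  rw [hcard] at hsum
  have hX2 := Real.log_le_sub_one_of_pos (x := X / 2 * κ) (by positivity)
  rw [Real.log_mul (by positivity) hκpos.ne', hκ, Real.log_div (by positivity) hg0.ne',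
    Real.log_pow, ← hκ] at hX2
  push_cast at hX2
  have hfin : κ * ((n - 1) * (1 / (g - 1)) + 1 / κ) ≤ κ * (∑ k ∈ Finset.Ico 1 n, B k + X / 2) := by
    rw [mul_add, mul_one_div_cancel hκpos.ne']
    linarith
  have hfin := le_of_mul_le_mul_left hfin hκpos
  have h6 : 1 / (g - 1) ≤ 1 / κ := by
    refine one_div_le_one_div_of_le hκpos ?_
    rw [hκ, div_le_iff₀ hg0]
    nlinarith
  have h7 : (n : ℝ) * ((g + 1) / (g - 1)) = n + 2 * (n * (1 / (g - 1))) := by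
    field_simp
    ring
  rw [htot, h7]
  linarith

end Entropy
section Network

/-- A finite reversible network with total vertex weights `m`, edges of conductance `w` inside
the network and edges of conductance `β` to the target; the remaining weight is killed. -/
structure KilledNetwork (ι : Type*) [Fintype ι] where
  w : ι → ι → ℝ
  β : ι → ℝ
  m : ι → ℝ
  w_nonneg : ∀ x y, 0 ≤ w x y
  w_symm : ∀ x y, w x y = w y x
  β_nonneg : ∀ x, 0 ≤ β x
  m_pos : ∀ x, 0 < m x
  sum_le : ∀ x, ∑ y, w x y + β x ≤ m x

lemma differentiableAt_det {ι : Type*} [Fintype ι] {A : ℝ → Matrix ι ι ℝ} {t : ℝ}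
    (h : ∀ i j, DifferentiableAt ℝ (fun s => A s i j) t) :
    DifferentiableAt ℝ (fun s => (A s).det) t := by
  simp only [Matrix.det_apply']
  refine DifferentiableAt.fun_sum fun σ _ => ?_
  refine (differentiableAt_const _).mul ?_
  exact DifferentiableAt.fun_finsetProd fun i _ => h _ _

namespace KilledNetwork

variable {ι : Type*} [Fintype ι] (N : KilledNetwork ι)

/-- The operator `m - s w`. -/
noncomputable def lap (s : ℝ) : Matrix ι ι ℝ :=
  Matrix.of fun x y => (if x = y then N.m x else 0) - s * N.w x y

lemma lap_mulVec (s : ℝ) (u : ι → ℝ) (x : ι) :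
    (N.lap s).mulVec u x = N.m x * u x - s * ∑ y, N.w x y * u y := by
  simp [lap, Matrix.mulVec, dotProduct, sub_mul, Finset.sum_sub_distrib, Finset.mul_sum, mul_assoc]

lemma sum_w_le (x : ι) : ∑ y, N.w x y ≤ N.m x := by
  linarith [N.sum_le x, N.β_nonneg x]

/-- Minimum principle. -/
lemma nonneg_of_lap_mulVec_nonneg {s : ℝ} (hs : s ∈ Set.Ico (0 : ℝ) 1) {u : ι → ℝ}
    (h : ∀ x, 0 ≤ (N.lap s).mulVec u x) (x : ι) : 0 ≤ u x := by
  have : Nonempty ι := ⟨x⟩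
  obtain ⟨x₀, hx₀⟩ := Finite.exists_min u
  refine le_trans ?_ (hx₀ x)
  by_contra! hneg
  have h1 := h x₀
  rw [lap_mulVec] at h1
  have h2 : (∑ y, N.w x₀ y) * u x₀ ≤ ∑ y, N.w x₀ y * u y := by
    rw [Finset.sum_mul]
    exact Finset.sum_le_sum fun y _ => mul_le_mul_of_nonneg_left (hx₀ y) (N.w_nonneg _ _)
  have h3 := mul_le_mul_of_nonneg_left h2 hs.1
  have h4 : s * ∑ y, N.w x₀ y < N.m x₀ := by
    have h5 := N.sum_w_le x₀
    have h6 : 0 ≤ ∑ y, N.w x₀ y := Finset.sum_nonneg fun y _ => N.w_nonneg _ _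
    have h7 := N.m_pos x₀
    nlinarith [hs.1, hs.2]
  nlinarith

lemma det_lap_ne_zero {s : ℝ} (hs : s ∈ Set.Ico (0 : ℝ) 1) : (N.lap s).det ≠ 0 := by
  intro h
  obtain ⟨u, hu, h0⟩ := Matrix.exists_mulVec_eq_zero_iff.2 h
  refine hu (funext fun x => le_antisymm ?_ ?_)
  · have := N.nonneg_of_lap_mulVec_nonneg hs (u := -u) (fun x => by simp [Matrix.mulVec_neg, h0]) x
    simpa using this
  · exact N.nonneg_of_lap_mulVec_nonneg hs (u := u) (fun x => by simp [h0]) x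

/-- The solution of `(m - s w) u = r`. -/
noncomputable def sol (s : ℝ) (r : ι → ℝ) : ι → ℝ := (N.lap s)⁻¹.mulVec r

lemma lap_mulVec_sol {s : ℝ} (hs : s ∈ Set.Ico (0 : ℝ) 1) (r : ι → ℝ) :
    (N.lap s).mulVec (N.sol s r) = r := by
  rw [sol, Matrix.mulVec_mulVec, Matrix.mul_nonsing_inv _ (N.det_lap_ne_zero hs).isUnit,
    Matrix.one_mulVec]

lemma sol_spec {s : ℝ} (hs : s ∈ Set.Ico (0 : ℝ) 1) (r : ι → ℝ) (x : ι) :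
    N.m x * N.sol s r x - s * ∑ y, N.w x y * N.sol s r y = r x := by
  rw [← lap_mulVec, N.lap_mulVec_sol hs]

lemma sol_nonneg {s : ℝ} (hs : s ∈ Set.Ico (0 : ℝ) 1) {r : ι → ℝ} (hr : ∀ x, 0 ≤ r x) (x : ι) :
    0 ≤ N.sol s r x :=
  N.nonneg_of_lap_mulVec_nonneg hs (fun x => by rw [N.lap_mulVec_sol hs]; exact hr x) x

lemma differentiableAt_sol {s : ℝ} (hs : s ∈ Set.Ico (0 : ℝ) 1) (r : ι → ℝ) (x : ι) :
    DifferentiableAt ℝ (fun t => N.sol t r x) s := by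
  have hlap : ∀ i j, DifferentiableAt ℝ (fun t => N.lap t i j) s := by
    intro i j
    simp only [lap, Matrix.of_apply]
    fun_prop
  simp only [sol, Matrix.mulVec, dotProduct, Matrix.inv_def, Ring.inverse_eq_inv',
    Matrix.smul_apply, smul_eq_mul, Matrix.adjugate_apply]
  refine DifferentiableAt.fun_sum fun y _ => ?_
  refine DifferentiableAt.mul (DifferentiableAt.mul ?_ ?_) (differentiableAt_const _)
  · exact (differentiableAt_det hlap).inv (N.det_lap_ne_zero hs)
  · refine differentiableAt_det fun i j => ?_
    simp only [Matrix.updateRow_apply]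
    split_ifs
    · exact differentiableAt_const _
    · exact hlap i j

/-- The generating function at `s` of the hitting time of the target. -/
noncomputable def hit (s : ℝ) (x : ι) : ℝ := s * N.sol s N.β x

lemma hit_spec {s : ℝ} (hs : s ∈ Set.Ico (0 : ℝ) 1) (x : ι) :
    N.m x * N.hit s x = s * (∑ y, N.w x y * N.hit s y + N.β x) := by
  have h := N.sol_spec hs N.β x
  have e : ∑ y, N.w x y * N.hit s y = s * ∑ y, N.w x y * N.sol s N.β y := by
    rw [Finset.mul_sum]
    exact Finset.sum_congr rfl fun y _ => by rw [hit]; ring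
  rw [e, hit]
  linear_combination s * h

lemma hit_nonneg {s : ℝ} (hs : s ∈ Set.Ico (0 : ℝ) 1) (x : ι) : 0 ≤ N.hit s x :=
  mul_nonneg hs.1 (N.sol_nonneg hs N.β_nonneg x)

lemma hit_le_self {s : ℝ} (hs : s ∈ Set.Ico (0 : ℝ) 1) (x : ι) : N.hit s x ≤ s := by
  suffices h : 0 ≤ s - N.hit s x by linarith
  refine N.nonneg_of_lap_mulVec_nonneg hs (u := fun x => s - N.hit s x) (fun x => ?_) x
  rw [lap_mulVec]
  simp only [mul_sub, Finset.sum_sub_distrib, ← Finset.sum_mul]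
  have h1 := N.hit_spec hs x
  have h2 : s * ∑ y, N.w x y ≤ ∑ y, N.w x y :=
    mul_le_of_le_one_left (Finset.sum_nonneg fun y _ => N.w_nonneg _ _) hs.2.le
  have h3 := mul_le_mul_of_nonneg_left (add_le_add_left h2 (N.β x)) hs.1
  have h4 := mul_le_mul_of_nonneg_left (N.sum_le x) hs.1
  linarith

lemma differentiableAt_hit {s : ℝ} (hs : s ∈ Set.Ico (0 : ℝ) 1) (x : ι) :
    DifferentiableAt ℝ (fun t => N.hit t x) s :=
  differentiableAt_id.mul (N.differentiableAt_sol hs N.β x)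

lemma hit_eq_zero_of_adj {s : ℝ} (hs : s ∈ Set.Ioo (0 : ℝ) 1) {x y : ι} (hxy : N.w x y ≠ 0)
    (hx : N.hit s x = 0) : N.hit s y = 0 := by
  have hs' : s ∈ Set.Ico (0 : ℝ) 1 := ⟨hs.1.le, hs.2⟩
  have h := N.hit_spec hs' x
  have hnn : ∀ y ∈ Finset.univ, 0 ≤ N.w x y * N.hit s y := fun y _ =>
    mul_nonneg (N.w_nonneg _ _) (N.hit_nonneg hs' y)
  have h1 : ∑ y, N.w x y * N.hit s y = 0 := by
    have h2 := Finset.sum_nonneg hnn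
    rw [hx, mul_zero, eq_comm, mul_eq_zero] at h
    have := h.resolve_left hs.1.ne'
    linarith [N.β_nonneg x]
  exact (mul_eq_zero.1 ((Finset.sum_eq_zero_iff_of_nonneg hnn).1 h1 y (Finset.mem_univ y))
    ).resolve_left hxy

/-- The Green function with pole at `o`, relative to the vertex weights. -/
noncomputable def green (s : ℝ) (o : ι) : ι → ℝ := N.sol s (fun x => if x = o then 1 else 0)

lemma mul_deriv_hit {s : ℝ} (hs : s ∈ Set.Ioo (0 : ℝ) 1) (o : ι) :
    s * deriv (fun t => N.hit t o) s = ∑ x, N.m x * N.hit s x * N.green s o x := by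
  have hs' : s ∈ Set.Ico (0 : ℝ) 1 := ⟨hs.1.le, hs.2⟩
  set d : ι → ℝ := fun x => deriv (fun t => N.hit t x) s with hd
  have hder : ∀ x, HasDerivAt (fun t => N.hit t x) (d x) s := fun x =>
    (N.differentiableAt_hit hs' x).hasDerivAt
  have hlin : ∀ x, s * (N.m x * d x - s * ∑ y, N.w x y * d y) = N.m x * N.hit s x := by
    intro x
    have h1 : HasDerivAt (fun t => N.m x * N.hit t x) (N.m x * d x) s := (hder x).const_mul _
    have h2 : HasDerivAt (fun t => t * (∑ y, N.w x y * N.hit t y + N.β x))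
        (1 * (∑ y, N.w x y * N.hit s y + N.β x) + s * ∑ y, N.w x y * d y) s :=
      (hasDerivAt_id s).mul
        ((HasDerivAt.fun_sum fun y _ => (hder y).const_mul (N.w x y)).add_const (N.β x))
    have h3 : (fun t => t * (∑ y, N.w x y * N.hit t y + N.β x))
        =ᶠ[nhds s] fun t => N.m x * N.hit t x := by
      filter_upwards [Ioo_mem_nhds hs.1 hs.2] with t ht
      exact (N.hit_spec ⟨ht.1.le, ht.2⟩ x).symm
    have h4 := (h2.congr_of_eventuallyEq h3.symm).unique h1
    have h5 := N.hit_spec hs' x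
    linear_combination (-s) * h4 - h5
  have hgr : ∀ x, N.m x * N.green s o x - s * ∑ y, N.w x y * N.green s o y
      = if x = o then 1 else 0 := fun x => N.sol_spec hs' _ x
  have e1 : ∑ x, N.m x * N.hit s x * N.green s o x
      = s * (∑ x, N.m x * d x * N.green s o x
        - s * ∑ x, ∑ y, N.w x y * d y * N.green s o x) := by
    simp only [← hlin, Finset.mul_sum, ← Finset.sum_sub_distrib, Finset.sum_mul, sub_mul, mul_sub]
    refine Finset.sum_congr rfl fun x _ => ?_
    congr 1
    · ring
    · refine Finset.sum_congr rfl fun y _ => by ring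
  have e2 : d o = ∑ x, d x * (if x = o then 1 else 0) := by simp
  have e3 : ∑ x, ∑ y, N.w x y * d y * N.green s o x
      = ∑ x, ∑ y, N.w x y * d x * N.green s o y := by
    rw [Finset.sum_comm]
    refine Finset.sum_congr rfl fun x _ => Finset.sum_congr rfl fun y _ => ?_
    rw [N.w_symm]
  change s * d o = _
  rw [e1, e2, e3]
  congr 1
  simp only [← hgr, mul_sub, Finset.sum_sub_distrib, Finset.mul_sum]
  congr 1
  · exact Finset.sum_congr rfl fun x _ => by ring
  · exact Finset.sum_congr rfl fun x _ => Finset.sum_congr rfl fun y _ => by ring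

/-- Lower bound for the logarithmic derivative of the hitting generating function, obtained by
applying `hitting_lower_bound` to the Doob transform of the network. -/
lemma mul_hit_le_mul_deriv_hit {l : ι → ℕ} {o : ι} {n : ℕ} {s g W : ℝ}
    (hs : s ∈ Set.Ioo (0 : ℝ) 1) (hn : 1 ≤ n) (hl : ∀ x, l x = 0 ↔ x = o)
    (hstep : ∀ x y, N.w x y ≠ 0 → l y ≤ l x + 1) (hβ : ∀ x, N.β x ≠ 0 → l x = n)
    (hg : 1 < g) (hW : 0 < W) (hβW : ∑ x, N.β x ≤ W) (hpos : 0 < N.hit s o)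
    (hsol : 2 * (s ^ 2 * W) ≤ (g - 1) ^ 2 * g ^ ((n : ℝ) - 2) * (N.m o * N.hit s o ^ 2)) :
    (1 + n * ((g + 1) / (g - 1))) * N.hit s o ≤ s * deriv (fun t => N.hit t o) s := by
  have hs' : s ∈ Set.Ico (0 : ℝ) 1 := ⟨hs.1.le, hs.2⟩
  have hs0 := hs.1
  set f := N.hit s with hf
  set V := N.green s o with hV
  have hf0 : ∀ x, 0 ≤ f x := N.hit_nonneg hs'
  have hV0 : ∀ x, 0 ≤ V x := N.sol_nonneg hs' fun x => by split_ifs <;> norm_num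
  have hfeq : ∀ x, N.m x * f x = s * (∑ y, N.w x y * f y + N.β x) := N.hit_spec hs'
  have hVeq : ∀ x, N.m x * V x - s * ∑ y, N.w x y * V y = if x = o then 1 else 0 :=
    N.sol_spec hs' _
  have hβo : N.β o = 0 := by
    by_contra h
    have h1 := hβ o h
    have h2 := (hl o).2 rfl
    omega
  have key := hitting_lower_bound (c := fun x y => N.w x y * (f x * f y))
    (b := fun x => N.β x * f x) (v := fun x => s / f o * (V x / f x)) (l := l) (o := o) (n := n)
    (g := g) (W := s * W)
    (fun x y => mul_nonneg (N.w_nonneg x y) (mul_nonneg (hf0 x) (hf0 y)))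
    (fun x y => by rw [N.w_symm, mul_comm (f x)])
    (fun x => mul_nonneg (N.β_nonneg x) (hf0 x))
    (fun x => mul_nonneg (div_nonneg hs0.le hpos.le) (div_nonneg (hV0 x) (hf0 x)))
    hn hl (fun x y h => hstep x y (left_ne_zero_of_mul h))
    (fun x h => hβ x (left_ne_zero_of_mul h)) ?_ hg (mul_pos hs0 hW) ?_ ?_
  · have e : ∑ x, (∑ y, N.w x y * (f x * f y) + N.β x * f x) * (s / f o * (V x / f x))
        = (s * deriv (fun t => N.hit t o) s) / f o := by
      rw [N.mul_deriv_hit hs, Finset.sum_div]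
      refine Finset.sum_congr rfl fun x _ => ?_
      have h1 : ∑ y, N.w x y * (f x * f y) + N.β x * f x = f x * (∑ y, N.w x y * f y + N.β x) := by
        rw [mul_add, Finset.mul_sum]
        congr 1
        · exact Finset.sum_congr rfl fun y _ => by ring
        · ring
      have h2 : f x * (∑ y, N.w x y * f y + N.β x) = f x * (N.m x * f x / s) := by
        rw [hfeq x]; field_simp
      rw [h1, h2]
      change _ = N.m x * f x * V x / f o
      by_cases hx : f x = 0
      · simp [hx]
      · field_simp
    rw [e, le_div_iff₀ hpos] at key
    exact key
  · intro x
    by_cases hx : f x = 0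
    · have hxo : x ≠ o := fun h => by rw [h] at hx; linarith
      simp [hx, hxo]
    · have h1 : ∀ y, N.w x y * (f x * f y) * (s / f o * (V x / f x) - s / f o * (V y / f y))
          = s / f o * (N.w x y * f y * V x - f x * (N.w x y * V y)) := by
        intro y
        by_cases hw : N.w x y = 0
        · simp [hw]
        · have hy : f y ≠ 0 := fun hy =>
            hx (N.hit_eq_zero_of_adj hs (N.w_symm x y ▸ hw) hy)
          field_simp
      simp only [h1]
      rw [← Finset.mul_sum, Finset.sum_sub_distrib, ← Finset.sum_mul, ← Finset.mul_sum]
      have h2 : N.β x * f x * (s / f o * (V x / f x)) = s / f o * (N.β x * V x) := by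
        field_simp
      rw [h2, ← mul_add]
      have h3 : s * ((∑ y, N.w x y * f y) * V x - f x * ∑ y, N.w x y * V y + N.β x * V x)
          = f x * if x = o then 1 else 0 := by
        linear_combination (-V x) * hfeq x + f x * hVeq x
      rw [div_mul_eq_mul_div, h3]
      by_cases hxo : x = o
      · subst hxo; simp [hx]
      · simp [hxo]
  · refine le_trans (Finset.sum_le_sum fun x _ => mul_le_mul_of_nonneg_left (N.hit_le_self hs' x)
      (N.β_nonneg x)) ?_
    rw [← Finset.sum_mul, mul_comm]
    exact mul_le_mul_of_nonneg_left hβW hs0.le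
  · have h1 : ∑ y, N.w o y * (f o * f y) = N.m o * f o ^ 2 / s := by
      have h2 : ∑ y, N.w o y * (f o * f y) = f o * ∑ y, N.w o y * f y := by
        rw [Finset.mul_sum]
        exact Finset.sum_congr rfl fun y _ => by ring
      have h3 := hfeq o
      rw [hβo, add_zero] at h3
      rw [h2, eq_div_iff hs0.ne']
      linear_combination (-f o) * h3
    rw [h1, mul_div_assoc', le_div_iff₀ hs0]
    linarith

/-- The value of `s` for which the biased walk with odds `1 : g` has `E[s ^ T'_{01}] = φ`. -/
noncomputable def param (g φ : ℝ) : ℝ := (g + 1) * φ / (g + φ ^ 2)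

lemma param_mem {g φ : ℝ} (hg : 1 < g) (hφ : φ ∈ Set.Ioo (0 : ℝ) 1) :
    param g φ ∈ Set.Ioo (0 : ℝ) 1 := by
  have h0 := hφ.1
  have h1 := hφ.2
  have hd : 0 < g + φ ^ 2 := by positivity
  refine ⟨by unfold param; positivity, ?_⟩
  rw [param, div_lt_one hd]
  nlinarith [mul_pos (sub_pos.2 h1) (sub_pos.2 (h1.trans hg))]

lemma hasDerivAt_param {g φ : ℝ} (hg : 1 < g) (hφ : φ ∈ Set.Ioo (0 : ℝ) 1) :
    HasDerivAt (param g) (param g φ / φ * ((g - φ ^ 2) / (g + φ ^ 2))) φ := by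
  have h0 := hφ.1
  have hd : 0 < g + φ ^ 2 := by positivity
  have h := ((hasDerivAt_id φ).const_mul (g + 1)).div
    (((hasDerivAt_pow 2 φ).const_add g)) hd.ne'
  refine h.congr_deriv ?_
  simp only [param, id]
  field_simp
  push_cast
  ring

theorem hit_param_le {l : ι → ℕ} {o : ι} {n : ℕ} {g W φ : ℝ}
    (hn : 1 ≤ n) (hl : ∀ x, l x = 0 ↔ x = o)
    (hstep : ∀ x y, N.w x y ≠ 0 → l y ≤ l x + 1) (hβ : ∀ x, N.β x ≠ 0 → l x = n)
    (hg : 1 < g) (hW : 0 < W) (hβW : ∑ x, N.β x ≤ W)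
    (hsol : 2 * W ≤ (g - 1) ^ 2 * g ^ ((n : ℝ) - 2) * N.m o) (hφ : φ ∈ Set.Ioo (0 : ℝ) 1) :
    N.hit (param g φ) o ≤ param g φ * φ ^ n := by
  set R : ℝ → ℝ := fun t => N.hit (param g t) o / (param g t * t ^ n) with hR
  have hden : ∀ t ∈ Set.Ioo (0 : ℝ) 1, 0 < param g t * t ^ n := fun t ht =>
    mul_pos (param_mem hg ht).1 (pow_pos ht.1 n)
  have hIco : ∀ t ∈ Set.Ioo (0 : ℝ) 1, param g t ∈ Set.Ico (0 : ℝ) 1 := fun t ht =>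
    ⟨(param_mem hg ht).1.le, (param_mem hg ht).2⟩
  by_contra! hcon
  have hR0 : 1 < R φ := by
    rw [hR]; simp only; rwa [one_lt_div (hden φ hφ)]
  have hderiv : ∀ t ∈ Set.Ioo (0 : ℝ) 1, ∃ d, HasDerivAt R d t ∧ (1 < R t → 0 ≤ d) := by
    intro t ht
    have hp := param_mem hg ht
    have ht0 := ht.1
    set σ := param g t with hσ
    set f' := deriv (fun t => N.hit t o) σ with hf'
    have h1 : HasDerivAt (fun t => N.hit (param g t) o)
        (f' * (σ / t * ((g - t ^ 2) / (g + t ^ 2)))) t :=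
      HasDerivAt.comp t (N.differentiableAt_hit (hIco t ht) o).hasDerivAt (hasDerivAt_param hg ht)
    have h2 := (hasDerivAt_param hg ht).mul (hasDerivAt_pow n t)
    have h3 := h1.div h2 (hden t ht).ne'
    refine ⟨_, h3, fun hRt => ?_⟩
    have hRt' : σ * t ^ n < N.hit σ o := by
      rw [hR] at hRt; simp only at hRt; rwa [one_lt_div (hden t ht)] at hRt
    have hFpos : 0 < N.hit σ o := (hden t ht).trans hRt'
    have ht2 : t ^ 2 < 1 := by nlinarith [ht.1, ht.2]
    have hmono : 2 * (σ ^ 2 * W) ≤ (g / t ^ 2 - 1) ^ 2 * (g / t ^ 2) ^ ((n : ℝ) - 2)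
        * (N.m o * N.hit σ o ^ 2) := by
      have e1 : (g / t ^ 2) ^ ((n : ℝ) - 2) = g ^ ((n : ℝ) - 2) * t ^ 4 / (t ^ n) ^ 2 := by
        rw [Real.div_rpow (by linarith) (by positivity), ← Real.rpow_natCast t 2,
          ← Real.rpow_mul ht0.le, mul_sub, Real.rpow_sub ht0]
        rw [← pow_mul, ← Real.rpow_natCast t (n * 2), ← Real.rpow_natCast t 4]
        push_cast
        rw [mul_comm (2 : ℝ) n, show (2 : ℝ) * 2 = 4 by norm_num]
        rw [div_div_eq_mul_div]
      have e2 : (g / t ^ 2 - 1) ^ 2 * (g ^ ((n : ℝ) - 2) * t ^ 4 / (t ^ n) ^ 2)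
          = (g - t ^ 2) ^ 2 * g ^ ((n : ℝ) - 2) / (t ^ n) ^ 2 := by
        field_simp
      have hgp : 0 < g ^ ((n : ℝ) - 2) := Real.rpow_pos_of_pos (by linarith) _
      have hmo := N.m_pos o
      have e3 : (g - 1) ^ 2 ≤ (g - t ^ 2) ^ 2 := by
        apply pow_le_pow_left₀ <;> linarith
      have e4 : (σ * t ^ n) ^ 2 ≤ N.hit σ o ^ 2 := pow_le_pow_left₀ (hden t ht).le hRt'.le 2
      rw [e1, e2, div_mul_eq_mul_div, le_div_iff₀ (by positivity)]
      calc 2 * (σ ^ 2 * W) * (t ^ n) ^ 2 = (σ * t ^ n) ^ 2 * (2 * W) := by ring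
        _ ≤ N.hit σ o ^ 2 * ((g - 1) ^ 2 * g ^ ((n : ℝ) - 2) * N.m o) :=
          mul_le_mul e4 hsol (by positivity) (by positivity)
        _ ≤ N.hit σ o ^ 2 * ((g - t ^ 2) ^ 2 * g ^ ((n : ℝ) - 2) * N.m o) := by gcongr
        _ = _ := by ring
    have hghat : 1 < g / t ^ 2 := by rw [one_lt_div (by positivity)]; linarith
    have hmain := N.mul_hit_le_mul_deriv_hit hp hn hl hstep hβ hghat hW hβW hFpos hmono
    have hgt : 0 < g - t ^ 2 := by linarith
    have hgt' : 0 < g + t ^ 2 := by positivity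
    have hk : (g / t ^ 2 + 1) / (g / t ^ 2 - 1) = (g + t ^ 2) / (g - t ^ 2) := by
      field_simp
    rw [hk, ← hf'] at hmain
    refine div_nonneg ?_ (by positivity)
    have htn : (n : ℝ) * t ^ (n - 1) = n * t ^ n / t := by
      rw [eq_div_iff ht0.ne', mul_assoc, ← pow_succ, Nat.sub_add_cancel hn]
    rw [htn, ← hσ]
    have hfac : f' * (σ / t * ((g - t ^ 2) / (g + t ^ 2))) * (σ * t ^ n) -
        N.hit σ o * (σ / t * ((g - t ^ 2) / (g + t ^ 2)) * t ^ n + σ * (n * t ^ n / t))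
        = σ * t ^ n / t * ((g - t ^ 2) / (g + t ^ 2)) *
          (σ * f' - (1 + n * ((g + t ^ 2) / (g - t ^ 2))) * N.hit σ o) := by
      field_simp
    have h5 : 0 ≤ σ * t ^ n / t * ((g - t ^ 2) / (g + t ^ 2)) :=
      mul_nonneg (div_nonneg (hden t ht).le ht0.le) (by positivity)
    have h6 := mul_nonneg h5 (sub_nonneg.2 hmain)
    rw [← hfac] at h6
    exact h6
  choose! R' hR' hR'nn using hderiv
  set ε := R φ - 1 with hε
  have hε0 : 0 < ε := by linarith
  have hbound : ∀ b ∈ Set.Ioo φ 1, R φ - ε * (b - φ) ≤ R b := by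
    intro b hb
    have hsub : ∀ t ∈ Set.Icc φ b, t ∈ Set.Ioo (0 : ℝ) 1 := fun t ht =>
      ⟨hφ.1.trans_le ht.1, ht.2.trans_lt hb.2⟩
    have h := image_le_of_deriv_right_lt_deriv_boundary (f := fun t => -R t)
      (f' := fun t => -R' t) (a := φ) (b := b) (B := fun t => -R φ + ε * (t - φ))
      (B' := fun _ => ε)
      (fun t ht => (hR' t (hsub t ht)).continuousAt.neg.continuousWithinAt)
      (fun t ht => (hR' t (hsub t ⟨ht.1, ht.2.le⟩)).neg.hasDerivWithinAt)
      (by simp)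
      (fun t => by
        simpa using (((hasDerivAt_id t).sub_const φ).const_mul ε).const_add (-R φ))
      (fun t ht heq => by
        have h1 : 1 < R t := by
          have h2 : ε * (t - φ) < ε * 1 := by
            apply mul_lt_mul_of_pos_left _ hε0
            linarith [ht.2, hb.2, hφ.1]
          linarith
        have := hR'nn t (hsub t ⟨ht.1, ht.2.le⟩) h1
        linarith)
      ⟨hb.1.le, le_rfl⟩
    linarith
  have hupper : ∀ b ∈ Set.Ioo φ 1, (R φ - ε * (b - φ)) * b ^ n ≤ 1 := by
    intro b hb
    have hb' : b ∈ Set.Ioo (0 : ℝ) 1 := ⟨hφ.1.trans hb.1, hb.2⟩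
    have h1 := hbound b hb
    have h2 := N.hit_le_self (hIco b hb') o
    rw [hR] at h1
    simp only at h1
    have hp := (param_mem hg hb').1
    rw [le_div_iff₀ (hden b hb')] at h1
    have h3 : param g b * ((R φ - ε * (b - φ)) * b ^ n) ≤ param g b * 1 := by
      rw [mul_one]; refine le_trans (le_of_eq ?_) (h1.trans h2); simp only [hR]; ring
    exact le_of_mul_le_mul_left h3 hp
  have hlim : Tendsto (fun b : ℝ => (R φ - ε * (b - φ)) * b ^ n) (nhdsWithin 1 (Set.Iio 1))
      (nhds ((R φ - ε * (1 - φ)) * 1 ^ n)) := by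
    apply tendsto_nhdsWithin_of_tendsto_nhds
    apply Continuous.tendsto
    fun_prop
  have := le_of_tendsto hlim (by
    filter_upwards [Ioo_mem_nhdsLT hφ.2] with b hb using hupper b hb)
  rw [one_pow, mul_one] at this
  nlinarith [hφ.1]

end KilledNetwork

end Network

section Chain

/-- `μ` is the law of the Markov chain with transition kernel `p` started at `o`. -/
def IsChain [MeasurableSpace V] (p : V → V → ℝ≥0∞) (o : V) (μ : Measure (ℕ → V)) : Prop :=
  IsProbabilityMeasure μ ∧
  ∀ (k : ℕ) (x : Fin (k+1) → V),
    μ {ω | ∀ i : Fin (k+1), ω (i : ℕ) = x i}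
      = (if x 0 = o then 1 else 0) * ∏ i : Fin k, p (x i.castSucc) (x i.succ)

/-- Trajectories staying in `A` up to time `k`. -/
def stay (A : Set V) (k : ℕ) : Set (ℕ → V) := {ω | ∀ i ≤ k, ω i ∈ A}

/-- Trajectories jumping from `A` to `Z` at time `k + 1`. -/
def exitAt (A Z : Set V) (k : ℕ) : Set (ℕ → V) := {ω | ω ∈ stay A k ∧ ω (k + 1) ∈ Z}

/-- Probability of being at `x` at time `k` without having left `A`. -/
noncomputable def occ [MeasurableSpace V] (μ : Measure (ℕ → V)) (A : Set V) (k : ℕ) (x : V) : ℝ≥0∞ :=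
  μ {ω | ω ∈ stay A k ∧ ω k = x}

lemma hitTime_of_mem_exitAt {A Z : Set V} (hAZ : Disjoint A Z) {k : ℕ} {ω : ℕ → V}
    (h : ω ∈ exitAt A Z k) : hitTime Z ω = (k + 1 : ℕ) := by
  refine le_antisymm (iInf₂_le (k + 1) h.2) (le_iInf₂ fun j hj => ?_)
  rw [Nat.cast_le]
  by_contra hlt
  exact Set.disjoint_left.1 hAZ (h.1 j (by omega)) hj

lemma hitTime_eq_top_or_mem_exitAt {Z : Set V} {ω : ℕ → V} (h0 : ω 0 ∉ Z) :
    hitTime Z ω = ⊤ ∨ ∃ k, ω ∈ exitAt Zᶜ Z k := by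
  by_cases h : ∃ k, ω k ∈ Z
  · right
    obtain ⟨j, hj⟩ : ∃ j, Nat.find h = j + 1 := Nat.exists_eq_succ_of_ne_zero fun h' =>
      h0 (h' ▸ Nat.find_spec h)
    refine ⟨j, fun i hi => Nat.find_min h (by omega), ?_⟩
    rw [← hj]; exact Nat.find_spec h
  · left
    push Not at h
    simp [hitTime, h]

lemma expNeg_natCast (lam : ℝ) (k : ℕ) :
    expNeg lam (k : ℝ≥0∞) = ENNReal.ofReal (Real.exp (-lam)) ^ k := by
  rw [expNeg, if_neg (ENNReal.natCast_ne_top k), ENNReal.toReal_natCast,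
    ← ENNReal.ofReal_pow (Real.exp_pos _).le, ← Real.exp_nat_mul, mul_comm]

lemma expNeg_anti {lam : ℝ} (hlam : 0 ≤ lam) {a b : ℝ≥0∞} (hab : a ≤ b) :
    expNeg lam b ≤ expNeg lam a := by
  unfold expNeg
  by_cases hb : b = ⊤
  · simp [hb]
  · have ha : a ≠ ⊤ := ne_top_of_le_ne_top hb hab
    rw [if_neg hb, if_neg ha]
    refine ENNReal.ofReal_le_ofReal (Real.exp_le_exp.2 ?_)
    have := ENNReal.toReal_mono hb hab
    nlinarith

lemma IsChain.measure_zero [MeasurableSpace V] {p : V → V → ℝ≥0∞} {o : V} {μ : Measure (ℕ → V)}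
    (h : IsChain p o μ) (x : V) : μ {ω | ω 0 = x} = if x = o then 1 else 0 := by
  have := h.2 0 (fun _ => x)
  simpa using this

lemma occ_of_notMem [MeasurableSpace V] {μ : Measure (ℕ → V)} {A : Set V} {k : ℕ} {x : V}
    (hx : x ∉ A) : occ μ A k x = 0 := by
  rw [occ]
  convert measure_empty (μ := μ)
  ext ω
  simp only [Set.mem_ofPred_eq, Set.mem_empty_iff_false, iff_false]
  rintro ⟨h1, h2⟩
  exact hx (h2 ▸ h1 _ le_rfl)

variable [MeasurableSpace V] [Countable V] [MeasurableSingletonClass V]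
  {p : V → V → ℝ≥0∞} {o : V} {μ : Measure (ℕ → V)}

lemma measurableSet_of_eval (k : ℕ) (S : Set (Fin (k + 1) → V)) :
    MeasurableSet {ω : ℕ → V | (fun i : Fin (k + 1) => ω i) ∈ S} :=
  measurableSet_preimage (measurable_pi_lambda (fun (ω : ℕ → V) (i : Fin (k + 1)) => ω i)
    fun i => measurable_pi_apply (i : ℕ)) S.to_countable.measurableSet

lemma measurableSet_coord (k : ℕ) (S : Set V) : MeasurableSet {ω : ℕ → V | ω k ∈ S} :=
  measurable_pi_apply k S.to_countable.measurableSet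

lemma measurableSet_stay (A : Set V) (k : ℕ) : MeasurableSet (stay A k) := by
  have : stay A k = ⋂ i ∈ Set.Iic k, {ω : ℕ → V | ω i ∈ A} := by ext; simp [stay]
  rw [this]
  exact MeasurableSet.biInter (Set.to_countable _) fun i _ => measurableSet_coord i A

lemma measurableSet_exitAt (A Z : Set V) (k : ℕ) : MeasurableSet (exitAt A Z k) :=
  (measurableSet_stay A k).inter (measurableSet_coord (k + 1) Z)

lemma IsChain.ae_zero (h : IsChain p o μ) : ∀ᵐ ω ∂μ, ω 0 = o := by
  have := h.1
  have h1 := h.measure_zero o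
  rw [if_pos rfl] at h1
  exact (prob_compl_eq_zero_iff (measurableSet_coord 0 {o})).2 h1

/-- Markov property. -/
lemma IsChain.measure_step (h : IsChain p o μ) (A : Set V) (k : ℕ) (x y : V) :
    μ {ω | (ω ∈ stay A k ∧ ω k = x) ∧ ω (k + 1) = y} = occ μ A k x * p x y := by
  set Q : Set (Fin (k + 1) → V) := {q | (∀ i, q i ∈ A) ∧ q (Fin.last k) = x} with hQ
  have hdis : ∀ (j : ℕ) (q q' : Fin (j + 1) → V), q ≠ q' →
      Disjoint {ω : ℕ → V | ∀ i : Fin (j + 1), ω i = q i} {ω | ∀ i : Fin (j + 1), ω i = q' i} := by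
    intro j q q' hne
    rw [Set.disjoint_left]
    intro ω h1 h2
    exact hne (funext fun i => (h1 i).symm.trans (h2 i))
  have hmeas : ∀ (j : ℕ) (q : Fin (j + 1) → V),
      MeasurableSet {ω : ℕ → V | ∀ i : Fin (j + 1), ω i = q i} := by
    intro j q
    have := measurableSet_of_eval j {q}
    simpa [funext_iff] using this
  have e1 : {ω : ℕ → V | ω ∈ stay A k ∧ ω k = x}
      = ⋃ q ∈ Q, {ω | ∀ i : Fin (k + 1), ω i = q i} := by
    ext ω
    simp only [Set.mem_ofPred_eq, Set.mem_iUnion, exists_prop, hQ, stay]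
    constructor
    · rintro ⟨h1, h2⟩
      exact ⟨fun i => ω i, ⟨fun i => h1 i (by omega), by simpa using h2⟩, fun i => rfl⟩
    · rintro ⟨q, ⟨h1, h2⟩, h3⟩
      refine ⟨fun i hi => ?_, ?_⟩
      · have := h3 ⟨i, by omega⟩
        simp only at this
        rw [this]; exact h1 _
      · have := h3 (Fin.last k)
        simp only [Fin.val_last] at this
        rw [this, h2]
  have e2 : {ω : ℕ → V | (ω ∈ stay A k ∧ ω k = x) ∧ ω (k + 1) = y}
      = ⋃ q ∈ Q, {ω | ∀ i : Fin (k + 1 + 1), ω i = (Fin.snoc q y : Fin (k + 1 + 1) → V) i} := by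
    have : {ω : ℕ → V | (ω ∈ stay A k ∧ ω k = x) ∧ ω (k + 1) = y}
      = {ω : ℕ → V | ω ∈ stay A k ∧ ω k = x} ∩ {ω | ω (k + 1) = y} := rfl
    rw [this, e1]
    ext ω
    simp only [Set.mem_inter_iff, Set.mem_iUnion, Set.mem_ofPred_eq, exists_prop,
      Fin.forall_fin_succ' (n := k + 1), Fin.snoc_castSucc, Fin.snoc_last, Fin.val_castSucc,
      Fin.val_last]
    tauto
  have hinj : ∀ q q' : Fin (k + 1) → V, q ≠ q' →
      (Fin.snoc q y : Fin (k + 1 + 1) → V) ≠ Fin.snoc q' y := by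
    intro q q' hne heq
    refine hne (funext fun i => ?_)
    have := congrFun heq i.castSucc
    simpa using this
  rw [occ, e1, e2, measure_biUnion Q.to_countable (fun q _ q' _ hne => hdis k q q' hne)
    (fun q _ => hmeas k q), measure_biUnion Q.to_countable
    (fun q _ q' _ hne => hdis (k + 1) _ _ (hinj q q' hne)) (fun q _ => hmeas (k + 1) _),
    ← ENNReal.tsum_mul_right]
  refine tsum_congr fun q => ?_
  rw [h.2, h.2, Fin.prod_univ_castSucc, mul_assoc]
  congr 2
  · refine Finset.prod_congr rfl fun i _ => ?_
    rw [Fin.succ_castSucc, Fin.snoc_castSucc, Fin.snoc_castSucc]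
  · rw [Fin.snoc_castSucc, q.2.2, Fin.succ_last, Fin.snoc_last]

lemma measure_eq_tsum_coord (k : ℕ) {S : Set (ℕ → V)} (hS : MeasurableSet S) :
    μ S = ∑' x, μ {ω | ω ∈ S ∧ ω k = x} := by
  have e : S = ⋃ x, {ω | ω ∈ S ∧ ω k = x} := by ext; simp
  conv_lhs => rw [e]
  refine measure_iUnion (fun x y hxy => ?_) fun x => hS.inter (measurableSet_coord k {x})
  rw [Function.onFun, Set.disjoint_left]
  rintro ω ⟨_, h1⟩ ⟨_, h2⟩
  exact hxy (h1.symm.trans h2)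

lemma IsChain.measure_exitAt (h : IsChain p o μ) (A Z : Set V) (k : ℕ) :
    μ (exitAt A Z k) = ∑' x, occ μ A k x * ∑' y, p x y * Z.indicator 1 y := by
  rw [measure_eq_tsum_coord k (measurableSet_exitAt A Z k)]
  refine tsum_congr fun x => ?_
  have hm : MeasurableSet {ω : ℕ → V | ω ∈ exitAt A Z k ∧ ω k = x} :=
    (measurableSet_exitAt A Z k).inter (measurableSet_coord k {x})
  rw [measure_eq_tsum_coord (k + 1) hm, ← ENNReal.tsum_mul_left]
  refine tsum_congr fun y => ?_
  by_cases hy : y ∈ Z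
  · rw [Set.indicator_of_mem hy, Pi.one_apply, mul_one, ← h.measure_step]
    congr 1
    ext ω
    constructor
    · rintro ⟨⟨⟨h1, -⟩, h2⟩, h3⟩
      exact ⟨⟨h1, h2⟩, h3⟩
    · rintro ⟨⟨h1, h2⟩, h3⟩
      exact ⟨⟨⟨h1, h3.symm ▸ hy⟩, h2⟩, h3⟩
  · rw [Set.indicator_of_notMem hy, mul_zero, mul_zero]
    convert measure_empty (μ := μ)
    ext ω
    simp only [Set.mem_ofPred_eq, Set.mem_empty_iff_false, iff_false]
    rintro ⟨⟨⟨-, h1⟩, -⟩, h3⟩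
    exact hy (h3 ▸ h1)

lemma IsChain.occ_succ (h : IsChain p o μ) (A : Set V) (k : ℕ) (y : V) :
    occ μ A (k + 1) y = A.indicator (fun y => ∑' x, occ μ A k x * p x y) y := by
  by_cases hy : y ∈ A
  · rw [Set.indicator_of_mem hy]
    have e : {ω : ℕ → V | ω ∈ stay A (k + 1) ∧ ω (k + 1) = y}
        = {ω | ω ∈ stay A k ∧ ω (k + 1) = y} := by
      ext ω
      simp only [stay, Set.mem_ofPred_eq]
      constructor
      · rintro ⟨h1, h2⟩
        exact ⟨fun i hi => h1 i (by omega), h2⟩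
      · rintro ⟨h1, h2⟩
        refine ⟨fun i hi => ?_, h2⟩
        rcases Nat.le_succ_iff.1 hi with hi | hi
        · exact h1 i hi
        · rw [hi, Nat.succ_eq_add_one, h2]; exact hy
    have hm : MeasurableSet {ω : ℕ → V | ω ∈ stay A k ∧ ω (k + 1) = y} :=
      (measurableSet_stay A k).inter (measurableSet_coord (k + 1) {y})
    rw [occ, e, measure_eq_tsum_coord k hm]
    refine tsum_congr fun x => ?_
    rw [← h.measure_step]
    congr 1
    ext ω
    exact and_right_comm
  · rw [Set.indicator_of_notMem hy, occ]
    convert measure_empty (μ := μ)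
    ext ω
    simp only [Set.mem_ofPred_eq, Set.mem_empty_iff_false, iff_false]
    rintro ⟨h1, h2⟩
    exact hy (h2 ▸ h1 _ le_rfl)

lemma IsChain.tsum_occ_mul (h : IsChain p o μ) {A Z : Set V} {s : ℝ≥0∞} {f : V → ℝ≥0∞}
    (hf : ∀ x ∈ A, f x = s * ∑' y, p x y * (Z.indicator 1 y + A.indicator f y)) (k : ℕ) :
    ∑' x, occ μ A k x * f x = s * μ (exitAt A Z k) + s * ∑' x, occ μ A (k + 1) x * f x := by
  have h1 : ∀ x, occ μ A k x * f x = s * (occ μ A k x * ∑' y, p x y * Z.indicator 1 y)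
      + s * ∑' y, occ μ A k x * (p x y * A.indicator f y) := by
    intro x
    by_cases hx : x ∈ A
    · rw [hf x hx]
      simp only [mul_add]
      rw [ENNReal.tsum_add, ENNReal.tsum_mul_left]
      ring
    · simp [occ_of_notMem hx]
  simp only [h1]
  rw [ENNReal.tsum_add, ENNReal.tsum_mul_left, ENNReal.tsum_mul_left, h.measure_exitAt,
    ENNReal.tsum_comm]
  congr 2
  refine tsum_congr fun y => ?_
  rw [h.occ_succ]
  by_cases hy : y ∈ A
  · rw [Set.indicator_of_mem hy, Set.indicator_of_mem hy, ← ENNReal.tsum_mul_right]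
    exact tsum_congr fun x => by ring
  · simp [Set.indicator_of_notMem hy]

/-- First-exit decomposition of a function which is `s`-harmonic on `A` with boundary value `1`
on `Z`. -/
lemma IsChain.eq_sum_exitAt (h : IsChain p o μ) {A Z : Set V} {s : ℝ≥0∞} {f : V → ℝ≥0∞}
    (hf : ∀ x ∈ A, f x = s * ∑' y, p x y * (Z.indicator 1 y + A.indicator f y)) (ho : o ∈ A)
    (N : ℕ) :
    f o = ∑ k ∈ Finset.range N, s ^ (k + 1) * μ (exitAt A Z k)
      + s ^ N * ∑' x, occ μ A N x * f x := by
  induction N with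
  | zero =>
    rw [Finset.sum_range_zero, zero_add, pow_zero, one_mul, tsum_eq_single o]
    · have : {ω : ℕ → V | ω ∈ stay A 0 ∧ ω 0 = o} = {ω | ω 0 = o} := by
        ext ω
        simp only [stay, Set.mem_ofPred_eq, and_iff_right_iff_imp]
        intro h1 i hi
        rw [Nat.le_zero.1 hi, h1]
        exact ho
      rw [occ, this, h.measure_zero, if_pos rfl, one_mul]
    · intro x hx
      have : occ μ A 0 x = 0 := by
        refine measure_mono_null (fun ω hω => hω.2) ((h.measure_zero x).trans (if_neg hx))
      rw [this, zero_mul]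
  | succ N ih =>
    rw [ih, h.tsum_occ_mul hf N, Finset.sum_range_succ, pow_succ]
    ring

lemma lintegral_expNeg_hitTime_le (h : IsChain p o μ) {Z : Set V} (ho : o ∉ Z) (lam : ℝ) :
    ∫⁻ ω, expNeg lam (hitTime Z ω) ∂μ
      ≤ ∑' k, ENNReal.ofReal (Real.exp (-lam)) ^ (k + 1) * μ (exitAt Zᶜ Z k) := by
  set s := ENNReal.ofReal (Real.exp (-lam)) with hs
  have h1 : ∀ k, s ^ (k + 1) * μ (exitAt Zᶜ Z k)
      = ∫⁻ ω, (exitAt Zᶜ Z k).indicator (fun _ => s ^ (k + 1)) ω ∂μ := fun k =>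
    (lintegral_indicator_const (measurableSet_exitAt _ _ k) _).symm
  simp only [h1]
  rw [← lintegral_tsum fun k =>
    (measurable_const.indicator (measurableSet_exitAt Zᶜ Z k)).aemeasurable]
  refine lintegral_mono_ae ?_
  filter_upwards [h.ae_zero] with ω hω
  rcases hitTime_eq_top_or_mem_exitAt (Z := Z) (ω := ω) (by rwa [hω]) with h2 | ⟨k, hk⟩
  · simp [h2, expNeg]
  · rw [hitTime_of_mem_exitAt disjoint_compl_left hk, expNeg_natCast, ← hs]
    refine le_trans (le_of_eq ?_) (ENNReal.le_tsum k)
    rw [Set.indicator_of_mem hk]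

lemma tsum_le_lintegral_expNeg_hitTime_add_one {A Z : Set V} (hAZ : Disjoint A Z) (lam : ℝ) :
    ∑' k, ENNReal.ofReal (Real.exp (-lam)) ^ (k + 2) * μ (exitAt A Z k)
      ≤ ∫⁻ ω, expNeg lam (hitTime Z ω + 1) ∂μ := by
  set s := ENNReal.ofReal (Real.exp (-lam)) with hs
  have h1 : ∀ k, s ^ (k + 2) * μ (exitAt A Z k)
      = ∫⁻ ω, (exitAt A Z k).indicator (fun _ => s ^ (k + 2)) ω ∂μ := fun k =>
    (lintegral_indicator_const (measurableSet_exitAt _ _ k) _).symm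
  simp only [h1]
  rw [← lintegral_tsum fun k =>
    (measurable_const.indicator (measurableSet_exitAt A Z k)).aemeasurable]
  refine lintegral_mono fun ω => ?_
  by_cases hex : ∃ k, ω ∈ exitAt A Z k
  · obtain ⟨k, hk⟩ := hex
    have h2 := hitTime_of_mem_exitAt hAZ hk
    rw [tsum_eq_single k, Set.indicator_of_mem hk, h2]
    · have := expNeg_natCast lam (k + 1 + 1)
      push_cast at this ⊢
      rw [this]
    · intro j hj
      refine Set.indicator_of_notMem (fun hj' => hj ?_) _
      have h3 := hitTime_of_mem_exitAt hAZ hj'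
      rw [h2, Nat.cast_inj] at h3
      omega
  · push Not at hex
    simp [hex]

lemma IsChain.tsum_occ_le_one (h : IsChain p o μ) (A : Set V) (k : ℕ) :
    ∑' x, occ μ A k x ≤ 1 := by
  have := h.1
  exact (measure_eq_tsum_coord k (measurableSet_stay A k)).symm.trans_le prob_le_one

end Chain

section Biased

lemma IsBiasedWalk.isChain {g : ℝ} {ν : Measure (ℕ → ℤ)} (h : IsBiasedWalk g ν) :
    IsChain (biasedStep g) 0 ν :=
  ⟨h.1, fun k x => by rw [h.2 k x]; congr⟩

lemma tsum_biasedStep_mul (g : ℝ) (a : ℤ) (f : ℤ → ℝ≥0∞) :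
    ∑' y, biasedStep g a y * f y
      = ENNReal.ofReal (g / (g + 1)) * f (a + 1) + ENNReal.ofReal (1 / (g + 1)) * f (a - 1) := by
  rw [tsum_eq_sum (s := {a + 1, a - 1})]
  · rw [Finset.sum_pair (by omega)]
    have : a - 1 ≠ a + 1 := by omega
    simp [biasedStep, this]
  · intro y hy
    simp only [Finset.mem_insert, Finset.mem_singleton, not_or] at hy
    simp [biasedStep, hy.1, hy.2]

lemma IsBiasedWalk.pow_le_tsum {g φ : ℝ} {ν : Measure (ℕ → ℤ)} (h : IsBiasedWalk g ν)
    (hg : 1 < g) (hφ : φ ∈ Set.Ioo (0 : ℝ) 1) {n : ℕ} (hn : 1 ≤ n) :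
    ENNReal.ofReal (φ ^ n) ≤ ∑' k, ENNReal.ofReal (KilledNetwork.param g φ) ^ (k + 1)
      * ν (exitAt {a : ℤ | a < n} {m | m = (n : ℤ)} k) := by
  have hp := KilledNetwork.param_mem hg hφ
  have hφ0 := hφ.1
  set s := KilledNetwork.param g φ with hs
  set f : ℤ → ℝ≥0∞ := fun a => ENNReal.ofReal (φ ^ ((n : ℤ) - a).toNat) with hf
  have hharm : ∀ x ∈ {a : ℤ | a < n}, f x = ENNReal.ofReal s * ∑' y, biasedStep g x y *
      (({m | m = (n : ℤ)} : Set ℤ).indicator 1 y + {a : ℤ | a < n}.indicator f y) := by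
    intro x hx
    obtain ⟨j, hj⟩ : ∃ j : ℕ, x = n - (j + 1) :=
      ⟨((n : ℤ) - x).toNat - 1, by have : x < n := hx; omega⟩
    have h1 : ({m | m = (n : ℤ)} : Set ℤ).indicator 1 (x + 1)
        + {a : ℤ | a < n}.indicator f (x + 1) = ENNReal.ofReal (φ ^ j) := by
      rcases Nat.eq_zero_or_pos j with h0 | h0
      · subst h0
        have : x + 1 = n := by rw [hj]; simp
        simp [this]
      · have h2 : x + 1 ≠ n := by omega
        have h3 : x + 1 < n := by omega
        have h4 : ((n : ℤ) - (x + 1)).toNat = j := by omega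
        simp [Set.indicator, h2, h3, hf, h4]
    have h2 : ({m | m = (n : ℤ)} : Set ℤ).indicator 1 (x - 1)
        + {a : ℤ | a < n}.indicator f (x - 1) = ENNReal.ofReal (φ ^ (j + 2)) := by
      have h2 : x - 1 ≠ n := by omega
      have h3 : x - 1 < n := by omega
      have h4 : ((n : ℤ) - (x - 1)).toNat = j + 2 := by omega
      simp only [Set.indicator, Set.mem_ofPred_eq, h2, h3, if_true, if_false, zero_add, hf, h4]
    have h3 : ((n : ℤ) - x).toNat = j + 1 := by omega
    rw [tsum_biasedStep_mul, h1, h2]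
    simp only [hf, h3]
    rw [← ENNReal.ofReal_mul (by positivity), ← ENNReal.ofReal_mul (by positivity),
      ← ENNReal.ofReal_add (by positivity) (by positivity), ← ENNReal.ofReal_mul hp.1.le]
    congr 1
    have hd : 0 < g + φ ^ 2 := by positivity
    rw [hs, KilledNetwork.param]
    field_simp
    ring
  have hlt : ENNReal.ofReal s < 1 := by
    rw [← ENNReal.ofReal_one]
    exact (ENNReal.ofReal_lt_ofReal_iff zero_lt_one).2 hp.2
  have hlim : Tendsto (fun N : ℕ => ∑' k, ENNReal.ofReal s ^ (k + 1)
      * ν (exitAt {a : ℤ | a < n} {m | m = (n : ℤ)} k) + ENNReal.ofReal s ^ N) atTop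
      (nhds (∑' k, ENNReal.ofReal s ^ (k + 1)
      * ν (exitAt {a : ℤ | a < n} {m | m = (n : ℤ)} k) + 0)) :=
    (ENNReal.tendsto_pow_atTop_nhds_zero_of_lt_one hlt).const_add _
  rw [add_zero] at hlim
  refine ge_of_tendsto' hlim fun N => ?_
  have h1 := h.isChain.eq_sum_exitAt hharm (show (0 : ℤ) < n by exact_mod_cast hn) N
  have h2 : f 0 = ENNReal.ofReal (φ ^ n) := by simp [hf]
  rw [← h2, h1]
  refine add_le_add (ENNReal.sum_le_tsum _) ?_
  refine mul_le_of_le_one_right' ?_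
  refine le_trans (ENNReal.tsum_le_tsum fun x => ?_) (h.isChain.tsum_occ_le_one {a : ℤ | a < n} N)
  refine mul_le_of_le_one_right' ?_
  simp only [hf]
  exact ENNReal.ofReal_le_one.2 (pow_le_one₀ hφ0.le hφ.2.le)

end Biased

section GraphNetwork

namespace WeightedGraph

variable (G : WeightedGraph V)

/-- `x` is the endpoint of a path of `k` positive-weight steps from `o`. -/
def reach (o : V) (k : ℕ) (x : V) : Prop :=
  ∃ p : ℕ → V, p 0 = o ∧ (∀ i, i < k → 0 < G.w (p i) (p (i + 1))) ∧ p k = x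

variable {G} in
lemma reach.succ {o x y : V} {k : ℕ} (h : G.reach o k x) (hxy : 0 < G.w x y) :
    G.reach o (k + 1) y := by
  obtain ⟨p, h0, hp, hk⟩ := h
  refine ⟨fun i => if i ≤ k then p i else y, by simpa using h0, fun i hi => ?_, by simp⟩
  rcases Nat.lt_succ_iff_lt_or_eq.1 hi with h1 | h1
  · simpa [h1.le, Nat.succ_le_of_lt h1] using hp i h1
  · simpa [h1, hk] using hxy

/-- Graph distance from `o`, truncated at `n`. -/
noncomputable def level (o : V) (n : ℕ) (x : V) : ℕ := sInf {k | n ≤ k ∨ G.reach o k x}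

lemma level_mem (o : V) (n : ℕ) (x : V) : n ≤ G.level o n x ∨ G.reach o (G.level o n x) x :=
  Nat.sInf_mem (s := {k | n ≤ k ∨ G.reach o k x}) ⟨n, Or.inl le_rfl⟩

lemma level_le (o : V) (n : ℕ) (x : V) : G.level o n x ≤ n :=
  Nat.sInf_le (Or.inl le_rfl)

lemma level_eq_zero_iff {o x : V} {n : ℕ} (hn : 1 ≤ n) : G.level o n x = 0 ↔ x = o := by
  constructor
  · intro h
    have h1 := G.level_mem o n x
    rw [h] at h1
    rcases h1 with h1 | ⟨p, h0, -, h2⟩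
    · omega
    · rw [← h2, h0]
  · rintro rfl
    exact Nat.le_zero.1 (Nat.sInf_le (Or.inr ⟨fun _ => x, rfl, by simp, rfl⟩))

lemma level_le_add_one {o x y : V} {n : ℕ} (hxy : 0 < G.w x y) :
    G.level o n y ≤ G.level o n x + 1 := by
  rcases G.level_mem o n x with h | h
  · exact (G.level_le o n y).trans (by omega)
  · exact Nat.sInf_le (Or.inr (h.succ hxy))

variable {G} in
lemma distGE.level_eq {o x y : V} {z : Set V} {n : ℕ} (h : G.distGE o z (n + 1))
    (hxy : 0 < G.w x y) (hy : y ∈ z) : G.level o n x = n := by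
  refine le_antisymm (G.level_le o n x) ?_
  rcases G.level_mem o n x with h1 | h1
  · exact h1
  · obtain ⟨p, h0, hp, hk⟩ := h1.succ hxy
    have := h _ p h0 hp (hk ▸ hy)
    omega

variable {G} in
lemma distGE.notMem {o : V} {z : Set V} {n : ℕ} (h : G.distGE o z (n + 1)) : o ∉ z := fun ho => by
  have := h 0 (fun _ => o) rfl (by simp) ho
  omega

/-- Total weight of the edges from `x` into `z`. -/
noncomputable def weightInto (z : Set V) (x : V) : ℝ≥0∞ := ∑' y, G.w x y * z.indicator 1 y

lemma vw_ne_zero (x : V) : G.vw x ≠ 0 := (G.vw_pos x).ne'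

lemma vw_ne_top (x : V) : G.vw x ≠ ⊤ := (G.vw_lt_top x).ne

lemma w_ne_top (x y : V) : G.w x y ≠ ⊤ := ne_top_of_le_ne_top (G.vw_ne_top x) (ENNReal.le_tsum y)

lemma weightInto_ne_top (z : Set V) (x : V) : G.weightInto z x ≠ ⊤ := by
  refine ne_top_of_le_ne_top (G.vw_ne_top x) (ENNReal.tsum_le_tsum fun y => ?_)
  exact mul_le_of_le_one_right' (Set.indicator_le_self' (by simp) y)

lemma tsum_weightInto (z : Set V) : ∑' x, G.weightInto z x = G.setWeight z := by
  simp only [weightInto, setWeight, vw]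
  rw [ENNReal.tsum_comm, tsum_subtype z fun y => ∑' x, G.w y x]
  refine tsum_congr fun y => ?_
  by_cases hy : y ∈ z
  · simp [hy, fun x => G.symm x y]
  · simp [hy]

lemma tsum_mul_indicator_coe (K : Finset V) (F f : V → ℝ≥0∞) :
    ∑' y, F y * (K : Set V).indicator f y = ∑ y : K, F y * f y := by
  rw [Finset.sum_coe_sort K fun y => F y * f y, tsum_eq_sum (s := K)]
  · exact Finset.sum_congr rfl fun y hy => by
      rw [Set.indicator_of_mem (Finset.mem_coe.2 hy)]
  · intro y hy
    rw [Set.indicator_of_notMem (by simpa using hy), mul_zero]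

lemma sum_add_weightInto_le {K : Finset V} {z : Set V} (hKz : Disjoint (K : Set V) z) (x : V) :
    ∑ y : K, G.w x y + G.weightInto z x ≤ G.vw x := by
  have h1 := tsum_mul_indicator_coe K (G.w x) 1
  simp only [Pi.one_apply, mul_one] at h1
  rw [← h1, weightInto, ← ENNReal.tsum_add]
  refine ENNReal.tsum_le_tsum fun y => ?_
  by_cases hy : y ∈ (K : Set V)
  · rw [Set.indicator_of_mem hy, Set.indicator_of_notMem (Set.disjoint_left.1 hKz hy)]
    simp
  · rw [Set.indicator_of_notMem hy, mul_zero, zero_add]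
    exact mul_le_of_le_one_right' (Set.indicator_le_self' (by simp) y)

/-- The random walk on a finite set `K` of vertices, with target `z`, killed outside `K ∪ z`. -/
noncomputable def killedNetwork (K : Finset V) (z : Set V) (hKz : Disjoint (K : Set V) z) :
    KilledNetwork K where
  w x y := (G.w x y).toReal
  β x := (G.weightInto z x).toReal
  m x := (G.vw x).toReal
  w_nonneg _ _ := ENNReal.toReal_nonneg
  w_symm x y := by rw [G.symm]
  β_nonneg _ := ENNReal.toReal_nonneg
  m_pos x := ENNReal.toReal_pos (G.vw_ne_zero x) (G.vw_ne_top x)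
  sum_le x := by
    rw [← ENNReal.toReal_sum fun (y : K) _ => G.w_ne_top x y, ← ENNReal.toReal_add
      (ENNReal.sum_ne_top.2 fun (y : K) _ => G.w_ne_top x y) (G.weightInto_ne_top z x)]
    exact ENNReal.toReal_mono (G.vw_ne_top x) (G.sum_add_weightInto_le hKz x)

lemma killedNetwork_hit_le {K : Finset V} {z : Set V} (hKz : Disjoint (K : Set V) z) {o : V}
    (ho : o ∈ K) {n : ℕ} (hn : 1 ≤ n) {g φ : ℝ} (hdist : G.distGE o z (n + 1)) (hg : 1 < g)
    (hsol : ENNReal.ofReal ((g - 1) ^ 2 * g ^ ((n : ℝ) - 2)) = 2 * G.setWeight z / G.vw o)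
    (hφ : φ ∈ Set.Ioo (0 : ℝ) 1) :
    (G.killedNetwork K z hKz).hit (KilledNetwork.param g φ) ⟨o, ho⟩
      ≤ KilledNetwork.param g φ * φ ^ n := by
  have hW1 : 2 * G.setWeight z
      = ENNReal.ofReal ((g - 1) ^ 2 * g ^ ((n : ℝ) - 2)) * G.vw o := by
    rw [hsol, ENNReal.div_mul_cancel (G.vw_ne_zero o) (G.vw_ne_top o)]
  have hpos : 0 < (g - 1) ^ 2 * g ^ ((n : ℝ) - 2) := by
    have : 0 < g - 1 := by linarith
    have : 0 < g := by linarith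
    positivity
  have hW2 : G.setWeight z ≠ ⊤ := by
    have h2 : 2 * G.setWeight z ≠ ⊤ := by
      rw [hW1]; exact ENNReal.mul_ne_top ENNReal.ofReal_ne_top (G.vw_ne_top o)
    exact fun h => h2 (by rw [h, ENNReal.mul_top two_ne_zero])
  have hW3 : 2 * (G.setWeight z).toReal
      = (g - 1) ^ 2 * g ^ ((n : ℝ) - 2) * (G.vw o).toReal := by
    have := congrArg ENNReal.toReal hW1
    rwa [ENNReal.toReal_mul, ENNReal.toReal_mul, ENNReal.toReal_ofReal hpos.le,
      ENNReal.toReal_ofNat] at this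
  have hvo : 0 < (G.vw o).toReal := ENNReal.toReal_pos (G.vw_ne_zero o) (G.vw_ne_top o)
  refine (G.killedNetwork K z hKz).hit_param_le (l := fun x => G.level o n x)
    (W := (G.setWeight z).toReal) hn (fun x => ?_) (fun x y hxy => ?_) (fun x hx => ?_) hg ?_ ?_
    hW3.le hφ
  · rw [G.level_eq_zero_iff hn, Subtype.ext_iff]
  · exact G.level_le_add_one (ENNReal.toReal_ne_zero.1 hxy).1.bot_lt
  · have h1 : G.weightInto z x ≠ 0 := (ENNReal.toReal_ne_zero.1 hx).1
    simp only [weightInto, ne_eq, ENNReal.tsum_eq_zero, not_forall] at h1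
    obtain ⟨y, hy⟩ := h1
    have hyz : y ∈ z := by
      by_contra h
      simp [h] at hy
    exact hdist.level_eq (left_ne_zero_of_mul hy).bot_lt hyz
  · have := mul_pos hpos hvo
    linarith
  · show ∑ x : K, (G.weightInto z x).toReal ≤ _
    rw [← ENNReal.toReal_sum fun (y : K) _ => G.weightInto_ne_top z y]
    refine ENNReal.toReal_mono hW2 ?_
    rw [← G.tsum_weightInto, Finset.sum_coe_sort K fun x => G.weightInto z x]
    exact ENNReal.sum_le_tsum K

lemma ofReal_killedNetwork_hit {K : Finset V} {z : Set V} (hKz : Disjoint (K : Set V) z)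
    {s : ℝ} (hs : s ∈ Set.Ico (0 : ℝ) 1) {f : V → ℝ≥0∞}
    (hf : ∀ x : K, f x = ENNReal.ofReal ((G.killedNetwork K z hKz).hit s x)) {x : V}
    (hx : x ∈ (K : Set V)) :
    f x = ENNReal.ofReal s
      * ∑' y, G.trans x y * (z.indicator 1 y + (K : Set V).indicator f y) := by
  set N := G.killedNetwork K z hKz with hN
  have hspec : (G.vw x).toReal * N.hit s ⟨x, hx⟩ = s * (∑ y : K, (G.w x y).toReal * N.hit s y
      + (G.weightInto z x).toReal) := N.hit_spec hs ⟨x, hx⟩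
  have h1 : ∑' y, G.trans x y * (z.indicator 1 y + (K : Set V).indicator f y)
      = (∑ y : K, G.w x y * f y + G.weightInto z x) / G.vw x := by
    rw [← tsum_mul_indicator_coe, weightInto, ← ENNReal.tsum_add, div_eq_mul_inv,
      ← ENNReal.tsum_mul_right]
    refine tsum_congr fun y => ?_
    rw [trans, div_eq_mul_inv]
    ring
  have h2 : ∑ y : K, G.w x y * f y + G.weightInto z x
      = ENNReal.ofReal (∑ y : K, (G.w x y).toReal * N.hit s y + (G.weightInto z x).toReal) := by
    rw [ENNReal.ofReal_add (Finset.sum_nonneg fun y _ => mul_nonneg ENNReal.toReal_nonneg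
        (N.hit_nonneg hs y)) ENNReal.toReal_nonneg,
      ENNReal.ofReal_sum_of_nonneg fun y _ => mul_nonneg ENNReal.toReal_nonneg
        (N.hit_nonneg hs y), ENNReal.ofReal_toReal (G.weightInto_ne_top z x)]
    congr 1
    refine Finset.sum_congr rfl fun y _ => ?_
    rw [ENNReal.ofReal_mul ENNReal.toReal_nonneg, ENNReal.ofReal_toReal (G.w_ne_top x y), hf]
  rw [h1, h2, ← mul_div_assoc, ← ENNReal.ofReal_mul hs.1, ← hspec,
    ENNReal.ofReal_mul ENNReal.toReal_nonneg, ENNReal.ofReal_toReal (G.vw_ne_top x),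
    mul_comm, ENNReal.mul_div_cancel_right (G.vw_ne_zero x) (G.vw_ne_top x)]
  exact hf ⟨x, hx⟩

end WeightedGraph

end GraphNetwork

section Domination

lemma IsRandomWalk.isChain [MeasurableSpace V] {G : WeightedGraph V} {o : V}
    {μ : Measure (ℕ → V)} (h : IsRandomWalk G o μ) : IsChain G.trans o μ := h

lemma exitAt_eq_iUnion (z : Set V) (k : ℕ) :
    exitAt zᶜ z k = ⋃ K : Finset V, exitAt ((K.filter (· ∉ z) : Finset V) : Set V) z k := by
  ext ω
  simp only [exitAt, stay, Set.mem_iUnion, Set.mem_ofPred_eq, Finset.coe_filter, Set.mem_compl_iff]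
  constructor
  · rintro ⟨h1, h2⟩
    refine ⟨(Finset.range (k + 1)).image ω, fun i hi => ⟨?_, h1 i hi⟩, h2⟩
    exact Finset.mem_image_of_mem _ (Finset.mem_range.2 (by omega))
  · rintro ⟨K, h1, h2⟩
    exact ⟨fun i hi => (h1 i hi).2, h2⟩

lemma monotone_exitAt (z : Set V) (k : ℕ) :
    Monotone fun K : Finset V => exitAt ((K.filter (· ∉ z) : Finset V) : Set V) z k := by
  intro K L hKL ω hω
  exact ⟨fun i hi => Finset.coe_subset.2 (Finset.filter_subset_filter _ hKL) (hω.1 i hi), hω.2⟩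

lemma disjoint_coe_filter (K : Finset V) (z : Set V) :
    Disjoint ((K.filter (· ∉ z) : Finset V) : Set V) z := by
  rw [Set.disjoint_left]
  intro x hx
  exact (Finset.mem_filter.1 hx).2

variable [Countable V] [MeasurableSpace V] [MeasurableSingletonClass V]
  {G : WeightedGraph V} {o : V} {z : Set V} {n : ℕ} {g φ : ℝ} {μ : Measure (ℕ → V)}

/-- Bound on the generating function of the hitting time for the walk on `G`. -/
lemma IsRandomWalk.tsum_exitAt_le (hμ : IsRandomWalk G o μ) (hn : 1 ≤ n)
    (hdist : G.distGE o z (n + 1)) (hg : 1 < g)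
    (hsol : ENNReal.ofReal ((g - 1) ^ 2 * g ^ ((n : ℝ) - 2)) = 2 * G.setWeight z / G.vw o)
    (hφ : φ ∈ Set.Ioo (0 : ℝ) 1) :
    ∑' k, ENNReal.ofReal (KilledNetwork.param g φ) ^ (k + 1) * μ (exitAt zᶜ z k)
      ≤ ENNReal.ofReal (KilledNetwork.param g φ * φ ^ n) := by
  have hp := KilledNetwork.param_mem hg hφ
  set s := KilledNetwork.param g φ with hs
  refine ENNReal.tsum_le_of_sum_range_le fun M => ?_
  have hlim : Tendsto (fun K : Finset V => ∑ k ∈ Finset.range M, ENNReal.ofReal s ^ (k + 1)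
        * μ (exitAt ((K.filter (· ∉ z) : Finset V) : Set V) z k)) atTop
      (nhds (∑ k ∈ Finset.range M, ENNReal.ofReal s ^ (k + 1) * μ (exitAt zᶜ z k))) := by
    refine tendsto_finsetSum _ fun k _ => ENNReal.Tendsto.const_mul ?_
      (Or.inr (ENNReal.pow_ne_top ENNReal.ofReal_ne_top))
    rw [exitAt_eq_iUnion]
    exact tendsto_measure_iUnion_atTop (monotone_exitAt z k)
  refine le_of_tendsto hlim ?_
  filter_upwards [eventually_ge_atTop {o}] with K hK
  have hKz := disjoint_coe_filter K z
  have ho : o ∈ K.filter (· ∉ z) :=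
    Finset.mem_filter.2 ⟨hK (Finset.mem_singleton_self o), hdist.notMem⟩
  set L := K.filter (· ∉ z)
  set f : V → ℝ≥0∞ := fun x => if h : x ∈ L then
    ENNReal.ofReal ((G.killedNetwork L z hKz).hit s ⟨x, h⟩) else 0 with hf
  have h1 := hμ.isChain.eq_sum_exitAt (Z := z) (f := f)
    (fun x hx => G.ofReal_killedNetwork_hit hKz ⟨hp.1.le, hp.2⟩
      (fun x => by simp [hf]) (x := x) hx) (Finset.mem_coe.2 ho) M
  refine le_trans (le_trans le_self_add h1.ge) ?_
  have h2 : f o = ENNReal.ofReal ((G.killedNetwork L z hKz).hit s ⟨o, ho⟩) := dif_pos ho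
  rw [h2]
  exact ENNReal.ofReal_le_ofReal (G.killedNetwork_hit_le hKz ho hn hdist hg hsol hφ)

lemma KilledNetwork.exists_param_eq {s : ℝ} (hg : 1 < g) (hs : s ∈ Set.Ioo (0 : ℝ) 1) :
    ∃ φ ∈ Set.Ioo (0 : ℝ) 1, KilledNetwork.param g φ = s := by
  have hc : ContinuousOn (KilledNetwork.param g) (Set.Icc 0 1) := by
    unfold KilledNetwork.param
    refine ContinuousOn.div (by fun_prop) (by fun_prop) fun x _ => ?_
    have : 0 < g + x ^ 2 := by positivity
    exact this.ne'
  have h0 : KilledNetwork.param g 0 = 0 := by simp [KilledNetwork.param]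
  have h1 : KilledNetwork.param g 1 = 1 := by
    rw [KilledNetwork.param, mul_one, one_pow, div_self (by linarith)]
  have := intermediate_value_Ioo zero_le_one hc
  rw [h0, h1] at this
  exact this hs

lemma IsBiasedWalk.one_le_lintegral_expNeg_zero {ν : Measure (ℕ → ℤ)} (hν : IsBiasedWalk g ν)
    (hg : 1 < g) (hn : 1 ≤ n) :
    1 ≤ ∫⁻ ω, expNeg 0 (hitTime {m : ℤ | m = (n : ℤ)} ω + 1) ∂ν := by
  have hdisj : Disjoint {a : ℤ | a < n} {m : ℤ | m = (n : ℤ)} :=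
    Set.disjoint_left.2 fun a (ha : a < n) ha' => ha.ne ha'
  have h1 := tsum_le_lintegral_expNeg_hitTime_add_one (μ := ν) hdisj 0
  have hlim : Tendsto (fun φ : ℝ => ENNReal.ofReal (φ ^ n)) (nhdsWithin 1 (Set.Iio 1))
      (nhds (ENNReal.ofReal (1 ^ n))) :=
    ((ENNReal.continuous_ofReal.comp (continuous_pow n)).tendsto 1).mono_left inf_le_left
  rw [one_pow, ENNReal.ofReal_one] at hlim
  refine le_of_tendsto hlim ?_
  filter_upwards [Ioo_mem_nhdsLT (zero_lt_one' ℝ)] with φ hφ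
  refine (hν.pow_le_tsum hg hφ hn).trans (le_trans (ENNReal.tsum_le_tsum fun k => ?_) h1)
  rw [neg_zero, Real.exp_zero, ENNReal.ofReal_one, one_pow]
  exact mul_le_mul_left (pow_le_one₀ zero_le
    (ENNReal.ofReal_le_one.2 (KilledNetwork.param_mem hg hφ).2.le)) _

end Domination

/-- Laplace transform domination: with `g > 1` solving
`(g-1)² g^{n-2} = 2 w_z/w_o`, for every `λ ≥ 0` one has
`E[e^{-λ (T'_{0n}+1)}] ≥ E[e^{-λ T_{oz}}]`, where `T'_{0n}` is the hitting time of `n`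
for the biased simple random walk on `ℤ` with odds `1 : g`. -/
theorem laplace_domination
    {V : Type*} [Countable V] [MeasurableSpace V] [MeasurableSingletonClass V]
    (G : WeightedGraph V) (o : V) (z : Set V) (n : ℕ) (g : ℝ)
    (μ : Measure (ℕ → V)) (hμ : IsRandomWalk G o μ)
    (ν : Measure (ℕ → ℤ)) (hν : IsBiasedWalk g ν)
    (hdist : G.distGE o z (n + 1))
    (hg : 1 < g)
    (hsol : ENNReal.ofReal ((g - 1) ^ 2 * g ^ ((n : ℝ) - 2)) = 2 * G.setWeight z / G.vw o)
    (lam : ℝ) (hlam : 0 ≤ lam) :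
    ∫⁻ ω, expNeg lam (hitTime z ω) ∂μ
      ≤ ∫⁻ ω, expNeg lam (hitTime {m : ℤ | m = (n : ℤ)} ω + 1) ∂ν := by
  have := hμ.1
  have := hν.1
  rcases Nat.eq_zero_or_pos n with rfl | hn
  · calc ∫⁻ ω, expNeg lam (hitTime z ω) ∂μ ≤ ∫⁻ _, expNeg lam 1 ∂μ := by
          refine lintegral_mono_ae ?_
          filter_upwards [hμ.isChain.ae_zero] with ω hω
          refine expNeg_anti hlam (le_iInf₂ fun k hk => ?_)
          have hk0 : k ≠ 0 := by
            rintro rfl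
            exact hdist.notMem (hω ▸ hk)
          exact_mod_cast Nat.one_le_iff_ne_zero.2 hk0
      _ = ∫⁻ _, expNeg lam 1 ∂ν := by simp
      _ ≤ _ := by
          refine lintegral_mono_ae ?_
          filter_upwards [hν.isChain.ae_zero] with ω hω
          refine expNeg_anti hlam ?_
          have : hitTime {m : ℤ | m = ((0 : ℕ) : ℤ)} ω ≤ (0 : ℕ) := iInf₂_le 0 (by simpa using hω)
          exact (add_le_add_left this 1).trans_eq (by simp)
  · rcases hlam.eq_or_lt with rfl | hpos
    · refine le_trans ?_ (hν.one_le_lintegral_expNeg_zero hg hn)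
      calc ∫⁻ ω, expNeg 0 (hitTime z ω) ∂μ ≤ ∫⁻ _, 1 ∂μ := by
            refine lintegral_mono fun ω => (expNeg_anti le_rfl zero_le).trans ?_
            simp [expNeg]
        _ = 1 := by simp
    · obtain ⟨φ, hφ, hs⟩ := KilledNetwork.exists_param_eq hg
        (s := Real.exp (-lam)) ⟨Real.exp_pos _, by simpa using hpos⟩
      have hdisj : Disjoint {a : ℤ | a < n} {m : ℤ | m = (n : ℤ)} :=
        Set.disjoint_left.2 fun a (ha : a < n) ha' => ha.ne ha'
      calc ∫⁻ ω, expNeg lam (hitTime z ω) ∂μ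
          ≤ ∑' k, ENNReal.ofReal (Real.exp (-lam)) ^ (k + 1) * μ (exitAt zᶜ z k) :=
            lintegral_expNeg_hitTime_le hμ.isChain hdist.notMem lam
        _ ≤ ENNReal.ofReal (Real.exp (-lam) * φ ^ n) :=
            hs ▸ hμ.tsum_exitAt_le hn hdist hg hsol hφ
        _ ≤ ENNReal.ofReal (Real.exp (-lam)) * ∑' k, ENNReal.ofReal (Real.exp (-lam)) ^ (k + 1)
              * ν (exitAt {a : ℤ | a < n} {m | m = (n : ℤ)} k) := by
            rw [ENNReal.ofReal_mul (Real.exp_pos _).le]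
            gcongr
            exact hs ▸ hν.pow_le_tsum hg hφ hn
        _ = ∑' k, ENNReal.ofReal (Real.exp (-lam)) ^ (k + 2)
              * ν (exitAt {a : ℤ | a < n} {m | m = (n : ℤ)} k) := by
            rw [← ENNReal.tsum_mul_left]
            exact tsum_congr fun k => by ring
        _ ≤ _ := tsum_le_lintegral_expNeg_hitTime_add_one hdisj lam

end RWHitting
end
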